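/- arXiv:math/0405315 — 4 statements merged into one kernel-verified Lean document; each statement's English description precedes it below -/
import Mathlib

section
/- For every integer d ≥ 3 and every field k of characteristic zero there exists a d-dimensional regular local domain (A, n) and a prime ideal P of A of height h := d−1 such that the extension PÂ of P to the n-adic completion Â of A is not integrally closed. -/
noncomputable section

/-- `r` is integral over the ideal `I`: it satisfies a monic equation
`r^n + a₁ r^(n-1) + ⋯ + aₙ = 0` with `aᵢ ∈ Iⁱ`. -/
def IsIntegralOverIdeal {R : Type*} [CommRing R] (I : Ideal R) (r : R) : Prop :=
  ∃ n : ℕ, 0 < n ∧ ∃ a : ℕ → R, (∀ i ∈ Finset.Icc 1 n, a i ∈ I ^ i) ∧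
    r ^ n + ∑ i ∈ Finset.Icc 1 n, a i * r ^ (n - i) = 0

/-- An ideal is integrally closed if every element integral over it belongs to it. -/
def IsIntegrallyClosedIdeal {R : Type*} [CommRing R] (I : Ideal R) : Prop :=
  ∀ r : R, IsIntegralOverIdeal I r → r ∈ I

theorem exists_eq_add_pow_mul {B W : Type*} [CommRing B] [CommRing W] [Algebra B W] {t : B}
    (h : ∀ w : W, ∃ b : B, ∃ w' : W, w = algebraMap B W b + t • w') (M : ℕ) (w : W) :
    ∃ b : B, ∃ w' : W, w = algebraMap B W b + t ^ M • w' := by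
  induction M with
  | zero => exact ⟨0, w, by simp⟩
  | succ M ih =>
    obtain ⟨b, w', rfl⟩ := ih
    obtain ⟨c, w'', rfl⟩ := h w'
    refine ⟨b + t ^ M * c, w'', ?_⟩
    simp only [map_add, map_mul, map_pow, Algebra.smul_def]
    ring

theorem exists_eq_pow_mul {B W : Type*} [CommRing B] [CommRing W] [Algebra B W] {t : B}
    (h : ∀ (b : B) (w : W), algebraMap B W b = t • w → ∃ c : B, algebraMap B W c = w)
    (M : ℕ) (b : B) (w : W) (hb : algebraMap B W b = t ^ M • w) :
    ∃ c : B, algebraMap B W c = w := by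
  induction M generalizing b w with
  | zero => exact ⟨b, by simpa using hb⟩
  | succ M ih =>
    obtain ⟨c, hc⟩ := ih b (t • w) (by rw [hb, pow_succ, mul_smul])
    exact h c w hc

/-- A ring extension `B ⊆ W` is flat as soon as it becomes free after inverting `t`, and `B` is
`t`-adically dense in `W` with `t W ∩ B = t B`. -/
theorem Module.Flat.of_dense_of_free_away {B W σ : Type*} [CommRing B] [CommRing W] [IsDomain W]
    [Algebra B W] [Fintype σ] (t : B) (ht : algebraMap B W t ≠ 0)
    (hinj : Function.Injective (algebraMap B W))
    (dense : ∀ w : W, ∃ b : B, ∃ w' : W, w = algebraMap B W b + t • w')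
    (pure : ∀ (b : B) (w : W), algebraMap B W b = t • w → ∃ c : B, algebraMap B W c = w)
    (e : σ → W) (indep : ∀ r : σ → B, ∑ s, r s • e s = 0 → ∀ s, r s = 0)
    (gen : ∀ w : W, ∃ M : ℕ, ∃ r : σ → B, t ^ M • w = ∑ s, r s • e s) :
    Module.Flat B W := by
  rw [Module.Flat.iff_forall_isTrivialRelation]
  intro l f x hfx
  choose m r hr using fun i ↦ gen (x i)
  set M := ∑ i, m i with hM
  have hm i : m i ≤ M := Finset.single_le_sum (fun _ _ ↦ Nat.zero_le _) (Finset.mem_univ i)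
  let q i s := t ^ (M - m i) * r i s
  have hq i : t ^ M • x i = ∑ s, q i s • e s := by
    simp only [q, mul_smul, ← Finset.smul_sum, ← hr]
    rw [smul_smul, ← pow_add, Nat.sub_add_cancel (hm i)]
  have hsyz : ∀ s, ∑ i, f i * q i s = 0 := by
    apply indep
    simp only [Finset.sum_smul, mul_smul]
    rw [Finset.sum_comm]
    simp only [← Finset.smul_sum, ← hq]
    simp only [smul_comm _ (t ^ M), ← Finset.smul_sum, hfx, smul_zero]
  choose b h hb using fun s ↦ exists_eq_add_pow_mul dense M (e s)
  have hpow : algebraMap B W (t ^ M) ≠ 0 := by rw [map_pow]; exact pow_ne_zero _ ht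
  have key i : algebraMap B W (∑ s, q i s * b s) = t ^ M • (x i - ∑ s, q i s • h s) := by
    rw [smul_sub, hq, Finset.smul_sum, ← Finset.sum_sub_distrib, map_sum]
    refine Finset.sum_congr rfl fun s _ ↦ ?_
    rw [hb s]
    simp only [Algebra.smul_def, map_mul, map_pow]
    ring
  choose c hc using fun i ↦ exists_eq_pow_mul pure M _ _ (key i)
  have htriv : ∀ s : Option σ, ∑ i, f i * s.elim (c i) (q i) = 0 := by
    rintro (_ | s)
    · apply hinj
      apply mul_left_cancel₀ hpow
      rw [map_zero, mul_zero, map_sum, Finset.mul_sum]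
      calc _ = ∑ i, algebraMap B W (f i * ∑ s, q i s * b s) := by
            refine Finset.sum_congr rfl fun i _ ↦ ?_
            rw [map_mul (algebraMap B W) (f i) (∑ s, q i s * b s), key, ← hc]
            simp only [Option.elim, Algebra.smul_def, map_mul]
            ring
        _ = algebraMap B W (∑ s, (∑ i, f i * q i s) * b s) := by
            rw [← map_sum]
            simp only [Finset.mul_sum, Finset.sum_mul, mul_assoc]
            rw [Finset.sum_comm]
        _ = 0 := by simp [hsyz]
    · exact hsyz s
  let E := (Fintype.equivFin (Option σ)).symm
  refine ⟨_, fun i j ↦ (E j).elim (c i) (q i), fun j ↦ (E j).elim 1 h, fun i ↦ ?_,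
    fun j ↦ htriv (E j)⟩
  rw [E.sum_comp (fun s ↦ (s.elim (c i) (q i)) • (s.elim 1 h : W)), Fintype.sum_option]
  simp [Algebra.smul_def, hc]

namespace TwistedRing

open MvPolynomial

variable (n : ℕ) (k : Type) [Field k]

/-- The variables `u i` and `s (i, j)`. -/
abbrev Vars : Type := Fin n ⊕ (Fin n × ℕ)

/-- The polynomial ring `k[t][u, s]`. -/
abbrev Poly : Type := MvPolynomial (Vars n) (Polynomial k)

/-- The polynomial ring `k(t)[u, s]`. -/
abbrev PolyL : Type := MvPolynomial (Vars n) (FractionRing (Polynomial k))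

variable {n k}

/-- The parameter `t` as an element of `k(t)`. -/
def tL : FractionRing (Polynomial k) := algebraMap (Polynomial k) _ Polynomial.X

theorem tL_ne_zero : (tL : FractionRing (Polynomial k)) ≠ 0 := by
  simp [tL]

variable (n k) in
/-- The embedding `k[t][u, s] → k(t)[u, s]` fixing `u i` and sending
`s (i, j)` to `s (i, j) - t⁻ʲ u i`. -/
def shift : Poly n k →ₐ[Polynomial k] PolyL n k :=
  aeval (Sum.elim (fun i ↦ X (Sum.inl i))
    (fun p ↦ X (Sum.inr p) - C (tL ^ p.2)⁻¹ * X (Sum.inl p.1)))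

variable (n k) in
/-- The endomorphism of `k(t)[u, s]` fixing `u i` and sending
`s (i, j)` to `s (i, j) + t⁻ʲ u i`. -/
def unshift : PolyL n k →ₐ[FractionRing (Polynomial k)] PolyL n k :=
  aeval (Sum.elim (fun i ↦ X (Sum.inl i))
    (fun p ↦ X (Sum.inr p) + C (tL ^ p.2)⁻¹ * X (Sum.inl p.1)))

theorem unshift_shift (w : Poly n k) :
    unshift n k (shift n k w) = map (algebraMap _ (FractionRing (Polynomial k))) w := by
  have : ((unshift n k).toRingHom.comp (shift n k).toRingHom) =
      map (algebraMap _ (FractionRing (Polynomial k))) := by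
    apply MvPolynomial.ringHom_ext
    · intro r
      simp [shift, algebraMap_eq, IsScalarTower.algebraMap_apply (Polynomial k)
        (FractionRing (Polynomial k)) (PolyL n k)]
    · rintro (i | p) <;> simp [shift, unshift]
  exact congr($this w)

theorem shift_injective : Function.Injective (shift n k) := by
  intro a b h
  apply MvPolynomial.map_injective _ (IsFractionRing.injective (Polynomial k)
    (FractionRing (Polynomial k)))
  rw [← unshift_shift, ← unshift_shift, h]

variable (n k) in
/-- The polynomials over `k(t)` that are even in each of the variables `u i`. -/
def evenSubalgebra : Subalgebra (Polynomial k) (PolyL n k) where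
  carrier := {p | ∀ m, coeff m p ≠ 0 → ∀ i, Even (m (Sum.inl i))}
  mul_mem' {p q} hp hq m hm i := by
    classical
    obtain ⟨a, ha, b, hb, rfl⟩ := Finset.mem_add.1 (support_mul p q (mem_support_iff.2 hm))
    exact (hp a (mem_support_iff.1 ha) i).add (hq b (mem_support_iff.1 hb) i)
  add_mem' {p q} hp hq m hm i := by
    by_cases h : coeff m p = 0
    · exact hq m (by simpa [h] using hm) i
    · exact hp m h i
  algebraMap_mem' r m hm i := by
    classical
    rw [IsScalarTower.algebraMap_apply (Polynomial k) (FractionRing (Polynomial k)) (PolyL n k),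
      algebraMap_eq, coeff_C] at hm
    obtain rfl : 0 = m := by by_contra h; simp [h] at hm
    simp

theorem mem_even_iff {p : PolyL n k} :
    p ∈ evenSubalgebra n k ↔ ∀ m, coeff m p ≠ 0 → ∀ i, Even (m (Sum.inl i)) := Iff.rfl

theorem C_mem_even (c : FractionRing (Polynomial k)) : (C c : PolyL n k) ∈ evenSubalgebra n k := by
  classical
  intro m hm i
  rw [coeff_C] at hm
  obtain rfl : 0 = m := by by_contra h; simp [h] at hm
  simp

theorem X_inr_mem_even (p : Fin n × ℕ) : (X (Sum.inr p) : PolyL n k) ∈ evenSubalgebra n k := by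
  classical
  intro m hm i
  rw [coeff_X] at hm
  obtain rfl : Finsupp.single (Sum.inr p) 1 = m := by by_contra h; simp [h] at hm
  simp

theorem X_inl_sq_mem_even (i : Fin n) : (X (Sum.inl i) ^ 2 : PolyL n k) ∈ evenSubalgebra n k := by
  classical
  intro m hm j
  rw [coeff_X_pow] at hm
  obtain rfl : Finsupp.single (Sum.inl i) 2 = m := by by_contra h; simp [h] at hm
  by_cases h : i = j <;> simp [h]

variable (n k) in
/-- The ring of polynomials that become even in each `u i` when
written in terms of `t`, `u` and the `s (i, j) + t⁻ʲ u i`. -/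
def A₀ : Subalgebra (Polynomial k) (Poly n k) := (evenSubalgebra n k).comap (shift n k)

theorem mem_A₀ {w : Poly n k} : w ∈ A₀ n k ↔ shift n k w ∈ evenSubalgebra n k := Iff.rfl

@[simp]
theorem shift_inl (i : Fin n) : shift n k (X (Sum.inl i)) = X (Sum.inl i) := by simp [shift]

@[simp]
theorem shift_inr (p : Fin n × ℕ) :
    shift n k (X (Sum.inr p)) = X (Sum.inr p) - C (tL ^ p.2)⁻¹ * X (Sum.inl p.1) := by
  simp [shift]

@[simp]
theorem shift_C_X : shift n k (C Polynomial.X) = C tL := by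
  rw [← algebraMap_eq, AlgHom.commutes, IsScalarTower.algebraMap_apply (Polynomial k)
    (FractionRing (Polynomial k)) (PolyL n k)]
  rfl

variable (n k) in
/-- The parameter `t`. -/
def t : A₀ n k := algebraMap (Polynomial k) _ Polynomial.X

@[simp]
theorem coe_t : (t n k : Poly n k) = C Polynomial.X := rfl

variable (k) in
/-- The element `f i = (u i) ^ 2`. -/
def f (i : Fin n) : A₀ n k := ⟨X (Sum.inl i) ^ 2, by
  rw [mem_A₀, map_pow, shift_inl]; exact X_inl_sq_mem_even i⟩

theorem shift_y (i : Fin n) (j : ℕ) :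
    shift n k (X (Sum.inl i) + C Polynomial.X ^ j * X (Sum.inr (i, j))) =
      C (tL ^ j) * X (Sum.inr (i, j)) := by
  have : (C (tL ^ j) * C (tL ^ j)⁻¹ : PolyL n k) = 1 := by
    rw [← C_mul, mul_inv_cancel₀ (pow_ne_zero _ tL_ne_zero), C_1]
  rw [map_add, map_mul, map_pow, shift_inl, shift_inr, shift_C_X, ← C_pow]
  linear_combination -X (Sum.inl i) * this

theorem shift_z (i : Fin n) (j : ℕ) :
    shift n k (X (Sum.inr (i, j)) - C Polynomial.X * X (Sum.inr (i, j + 1))) =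
      X (Sum.inr (i, j)) - C tL * X (Sum.inr (i, j + 1)) := by
  have : (C tL * C (tL ^ (j + 1))⁻¹ : PolyL n k) = C (tL ^ j)⁻¹ := by
    rw [← C_mul, pow_succ, mul_inv_rev, mul_inv_cancel_left₀ tL_ne_zero]
  rw [map_sub, map_mul, shift_inr, shift_inr, shift_C_X]
  linear_combination X (Sum.inl i) * this

variable (k) in
/-- The element `y i j = u i + t ^ j s (i, j)`. -/
def y (i : Fin n) (j : ℕ) : A₀ n k :=
  ⟨X (Sum.inl i) + C Polynomial.X ^ j * X (Sum.inr (i, j)), by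
    rw [mem_A₀, shift_y]; exact mul_mem (C_mem_even _) (X_inr_mem_even _)⟩

variable (k) in
/-- The element `z i j = s (i, j) - t s (i, j + 1)`. -/
def z (i : Fin n) (j : ℕ) : A₀ n k :=
  ⟨X (Sum.inr (i, j)) - C Polynomial.X * X (Sum.inr (i, j + 1)), by
    rw [mem_A₀, shift_z]
    exact sub_mem (X_inr_mem_even _) (mul_mem (C_mem_even _) (X_inr_mem_even _))⟩

@[simp]
theorem coe_f (i : Fin n) : (f k i : Poly n k) = X (Sum.inl i) ^ 2 := rfl

@[simp]
theorem coe_y (i : Fin n) (j : ℕ) :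
    (y k i j : Poly n k) = X (Sum.inl i) + C Polynomial.X ^ j * X (Sum.inr (i, j)) := rfl

@[simp]
theorem coe_z (i : Fin n) (j : ℕ) :
    (z k i j : Poly n k) = X (Sum.inr (i, j)) - C Polynomial.X * X (Sum.inr (i, j + 1)) := rfl

theorem mem_A₀_of_t_mul {w : Poly n k} (h : C Polynomial.X * w ∈ A₀ n k) : w ∈ A₀ n k := by
  have := mul_mem (C_mem_even (tL⁻¹)) (mem_A₀.1 h)
  rwa [map_mul, shift_C_X, ← mul_assoc, ← map_mul, inv_mul_cancel₀ tL_ne_zero, map_one,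
    one_mul] at this

theorem exists_eq_add_t_smul (w : Poly n k) :
    ∃ b : A₀ n k, ∃ w' : Poly n k, w = algebraMap (A₀ n k) (Poly n k) b + t n k • w' := by
  simp only [Algebra.smul_def]
  induction w using MvPolynomial.induction_on with
  | C a => exact ⟨algebraMap _ _ a, 0, by
      rw [← algebraMap_eq, mul_zero, add_zero]; rfl⟩
  | add p q hp hq =>
    obtain ⟨b, w, rfl⟩ := hp
    obtain ⟨b', w', rfl⟩ := hq
    exact ⟨b + b', w + w', by simp only [map_add]; ring1⟩
  | mul_X p v hp =>
    obtain ⟨b, w, rfl⟩ := hp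
    obtain ⟨b', w', h⟩ : ∃ b : A₀ n k, ∃ w : Poly n k,
        X v = algebraMap (A₀ n k) (Poly n k) b + algebraMap _ _ (t n k) * w := by
      rcases v with i | ⟨i, j⟩
      · exact ⟨y k i 1, -X (Sum.inr (i, 1)), by simp; ring1⟩
      · exact ⟨z k i j, X (Sum.inr (i, j + 1)), by simp⟩
    rw [h]
    exact ⟨b * b', w * algebraMap _ _ b' + algebraMap _ _ b * w' + algebraMap _ _ (t n k) * w * w',
      by simp only [map_mul]; ring1⟩

theorem smul_eq (a : A₀ n k) (w : Poly n k) : a • w = (a : Poly n k) * w := rfl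

/-- The exponent of the squarefree monomial in the `u i`, `i ∈ S`. -/
def sqfreeExp (S : Finset (Fin n)) : Vars n →₀ ℕ := ∑ i ∈ S, Finsupp.single (Sum.inl i) 1

theorem sqfreeExp_inl (S : Finset (Fin n)) (i : Fin n) :
    sqfreeExp S (Sum.inl i) = if i ∈ S then 1 else 0 := by
  simp [sqfreeExp, Finsupp.finsetSum_apply, Finsupp.single_apply]

variable (k) in
/-- The product of the `u i`, `i ∈ S`. -/
def sqfreeMon (S : Finset (Fin n)) : Poly n k := monomial (sqfreeExp S) 1

theorem sqfreeMon_insert {S : Finset (Fin n)} {i : Fin n} (h : i ∉ S) :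
    sqfreeMon k (insert i S) = X (Sum.inl i) * sqfreeMon k S := by
  rw [sqfreeMon, sqfreeExp, Finset.sum_insert h, X, sqfreeMon, monomial_mul, one_mul, sqfreeExp]

theorem sqfreeMon_indep (r : Finset (Fin n) → A₀ n k) (h : ∑ S, r S • sqfreeMon k S = 0)
    (S : Finset (Fin n)) : r S = 0 := by
  apply Subtype.ext
  apply shift_injective
  rw [ZeroMemClass.coe_zero, map_zero]
  by_contra hS
  obtain ⟨m, hm⟩ := exists_coeff_ne_zero hS
  have hs (T) : shift n k (sqfreeMon k T) = monomial (sqfreeExp T) 1 := by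
    induction T using Finset.induction_on with
    | empty =>
      have : sqfreeMon k (∅ : Finset (Fin n)) = 1 := rfl
      rw [this, map_one]; rfl
    | insert i T hi ih =>
      rw [sqfreeMon_insert hi, map_mul, ih, shift_inl, X, monomial_mul, one_mul, sqfreeExp,
        sqfreeExp, Finset.sum_insert hi]
  simp only [smul_eq] at h
  have h0 := congr(coeff (m + sqfreeExp S) (shift n k $h))
  simp only [map_sum, map_zero, coeff_zero, coeff_sum, map_mul, hs] at h0
  rw [Finset.sum_eq_single S] at h0
  · rw [coeff_mul_monomial, mul_one] at h0
    exact hm h0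
  · intro T _ hT
    rw [coeff_mul_monomial']
    split_ifs with hle
    · by_contra hne
      rw [mul_one] at hne
      apply hT
      ext i
      have h1 := mem_even_iff.1 (mem_A₀.1 (r T).2) _ hne i
      have h2 := mem_even_iff.1 (mem_A₀.1 (r S).2) _ hm i
      have h3 := hle (Sum.inl i)
      simp only [Finsupp.tsub_apply, Finsupp.add_apply, sqfreeExp_inl] at h1 h3
      by_cases hiS : i ∈ S <;> by_cases hiT : i ∈ T <;>
        simp only [hiS, hiT, if_true, if_false] at * <;> grind
    · rfl
  · simp

theorem inl_mul_mem_span {w : Poly n k}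
    (hw : w ∈ Submodule.span (A₀ n k) (Set.range (sqfreeMon (n := n) k))) (i : Fin n) :
    X (Sum.inl i) * w ∈ Submodule.span (A₀ n k) (Set.range (sqfreeMon (n := n) k)) := by
  induction hw using Submodule.span_induction with
  | mem x hx =>
    obtain ⟨S, rfl⟩ := hx
    by_cases h : i ∈ S
    · rw [← Finset.insert_erase h, sqfreeMon_insert (Finset.notMem_erase i S), ← mul_assoc, ← sq]
      exact Submodule.smul_mem _ (f k i) (Submodule.subset_span ⟨_, rfl⟩)
    · rw [← sqfreeMon_insert h]
      exact Submodule.subset_span ⟨_, rfl⟩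
  | zero => simp
  | add x y _ _ hx hy => rw [mul_add]; exact Submodule.add_mem _ hx hy
  | smul a x _ hx => rw [mul_smul_comm]; exact Submodule.smul_mem _ _ hx

theorem exists_t_pow_smul_eq (w : Poly n k) :
    ∃ M : ℕ, ∃ r : Finset (Fin n) → A₀ n k, t n k ^ M • w = ∑ S, r S • sqfreeMon k S := by
  suffices ∃ M : ℕ, t n k ^ M • w ∈
      Submodule.span (A₀ n k) (Set.range (sqfreeMon (n := n) k)) by
    obtain ⟨M, hM⟩ := this
    obtain ⟨r, hr⟩ := (Submodule.mem_span_range_iff_exists_fun _).1 hM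
    exact ⟨M, r, hr.symm⟩
  induction w using MvPolynomial.induction_on with
  | C a =>
    refine ⟨0, ?_⟩
    have : C a = (algebraMap (Polynomial k) (A₀ n k) a) • sqfreeMon (n := n) k ∅ := by
      have : sqfreeMon k (∅ : Finset (Fin n)) = 1 := rfl
      rw [this, Algebra.smul_def, mul_one]; rfl
    rw [pow_zero, one_smul, this]
    exact Submodule.smul_mem _ _ (Submodule.subset_span ⟨_, rfl⟩)
  | add p q hp hq =>
    obtain ⟨M, hM⟩ := hp
    obtain ⟨N, hN⟩ := hq
    refine ⟨M + N, ?_⟩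
    rw [smul_add]
    refine Submodule.add_mem _ ?_ ?_
    · rw [pow_add, mul_comm, mul_smul]
      exact Submodule.smul_mem _ _ hM
    · rw [pow_add, mul_smul]
      exact Submodule.smul_mem _ _ hN
  | mul_X p v hp =>
    obtain ⟨M, hM⟩ := hp
    rcases v with i | ⟨i, j⟩
    · refine ⟨M, ?_⟩
      rw [mul_comm, ← mul_smul_comm]
      exact inl_mul_mem_span hM i
    · refine ⟨M + j, ?_⟩
      have : t n k ^ (M + j) • (p * X (Sum.inr (i, j))) =
          y k i j • (t n k ^ M • p) + (-1 : A₀ n k) • (X (Sum.inl i) * (t n k ^ M • p)) := by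
        simp only [smul_eq, SubmonoidClass.coe_pow, NegMemClass.coe_neg,
          OneMemClass.coe_one, coe_t, coe_y]
        ring
      rw [this]
      have h1 := Submodule.smul_mem _ (y k i j) hM
      have h2 := Submodule.smul_mem _ (-1 : A₀ n k) (inl_mul_mem_span hM i)
      exact Submodule.add_mem _ h1 h2

theorem coe_t_ne_zero : (t n k : Poly n k) ≠ 0 := by
  rw [coe_t]; exact C_ne_zero.2 Polynomial.X_ne_zero

theorem exists_eq_of_coe_eq_t_smul (b : A₀ n k) (w : Poly n k)
    (h : algebraMap (A₀ n k) (Poly n k) b = t n k • w) :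
    ∃ c : A₀ n k, algebraMap (A₀ n k) (Poly n k) c = w := by
  refine ⟨⟨w, mem_A₀_of_t_mul ?_⟩, rfl⟩
  rw [← coe_t, ← smul_eq, ← h]
  exact b.2

instance flat : Module.Flat (A₀ n k) (Poly n k) :=
  Module.Flat.of_dense_of_free_away (t n k) coe_t_ne_zero Subtype.val_injective
    exists_eq_add_t_smul exists_eq_of_coe_eq_t_smul (sqfreeMon k) sqfreeMon_indep
    exists_t_pow_smul_eq

end TwistedRing

theorem IsNoetherianRing.of_localization_factor {W S R : Type*} [CommRing W] [CommRing S]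
    [CommRing R] [Algebra W R] (M : Submonoid W) [IsLocalization M R] [IsNoetherianRing S]
    (φ : W →+* S) (θ : S →+* R) (h : θ.comp φ = algebraMap W R) : IsNoetherianRing R := by
  rw [isNoetherianRing_iff_ideal_fg]
  intro J
  rw [← IsLocalization.map_under M R J, ← h, ← Ideal.map_map]
  exact Ideal.FG.map (IsNoetherian.noetherian _) θ

theorem IsNoetherianRing.of_flat_of_isLocalHom {A R : Type*} [CommRing A] [CommRing R]
    [IsLocalRing A] [IsLocalRing R] (g : A →+* R) (hg : g.Flat) (hl : IsLocalHom g)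
    [IsNoetherianRing R] : IsNoetherianRing A := by
  let := g.toAlgebra
  have : Module.Flat A R := hg
  have : IsLocalHom (algebraMap A R) := hl
  have : Module.FaithfullyFlat A R := Module.FaithfullyFlat.of_flat_of_isLocalHom
  rw [isNoetherianRing_iff, isNoetherian_iff']
  have : StrictMono (Ideal.map (algebraMap A R)) := by
    refine Monotone.strictMono_of_injective (fun _ _ h ↦ Ideal.map_mono h) fun I J h ↦ ?_
    rw [← Ideal.comap_map_eq_self_of_faithfullyFlat (B := R) I, h,
      Ideal.comap_map_eq_self_of_faithfullyFlat]
  exact this.wellFoundedGT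

namespace TwistedRing

open MvPolynomial

variable (n : ℕ) (k : Type) [Field k]

/-- The field `k(s)`. -/
abbrev ResField : Type := FractionRing (MvPolynomial (Fin n × ℕ) k)

/-- The evaluation `k[t][u, s] → k(s)` at `t = 0` and `u = 0`. -/
def residue : Poly n k →+* ResField n k :=
  eval₂Hom (((algebraMap (MvPolynomial (Fin n × ℕ) k) (ResField n k)).comp C).comp
    (Polynomial.evalRingHom 0)) (Sum.elim (fun _ ↦ 0)
    fun p ↦ algebraMap (MvPolynomial (Fin n × ℕ) k) _ (X p))

/-- The prime `(t, u)` of `k[t][u, s]`. -/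
def primeW : Ideal (Poly n k) := RingHom.ker (residue n k)

instance : (primeW n k).IsPrime := RingHom.ker_isPrime _

/-- The ring `A₀`, with its instances sealed. -/
def Base : Type := A₀ n k

instance : CommRing (Base n k) := inferInstanceAs (CommRing (A₀ n k))

instance : Algebra (Base n k) (Poly n k) := inferInstanceAs (Algebra (A₀ n k) (Poly n k))

instance : Module.Flat (Base n k) (Poly n k) := flat

instance : IsDomain (Base n k) := inferInstanceAs (IsDomain (A₀ n k))

instance : Algebra k (Base n k) :=
  ((algebraMap (Polynomial k) (A₀ n k)).comp Polynomial.C).toAlgebra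

/-- The contraction of the prime `(t, u)`. -/
def primeA : Ideal (Base n k) := (primeW n k).comap (algebraMap (Base n k) (Poly n k))

instance : (primeA n k).IsPrime := Ideal.comap_isPrime _ _

/-- The localization of `k[t][u, s]` at `(t, u)`. -/
abbrev RegW : Type := Localization.AtPrime (primeW n k)

/-- The local ring of interest. -/
abbrev RegA : Type := Localization.AtPrime (primeA n k)

variable {n k}

@[simp]
theorem residue_C (a : Polynomial k) :
    residue n k (C a) = algebraMap (MvPolynomial (Fin n × ℕ) k) _ (C (a.eval 0)) := by
  simp [residue]

@[simp]
theorem residue_inl (i : Fin n) : residue n k (X (Sum.inl i)) = 0 := by simp [residue]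

@[simp]
theorem residue_inr (p : Fin n × ℕ) :
    residue n k (X (Sum.inr p)) = algebraMap (MvPolynomial (Fin n × ℕ) k) _ (X p) := by
  simp [residue]

theorem mem_primeW {w : Poly n k} : w ∈ primeW n k ↔ residue n k w = 0 := Iff.rfl

theorem mem_primeA {a : Base n k} : a ∈ primeA n k ↔ residue n k (algebraMap _ _ a) = 0 := Iff.rfl

theorem algebraMap_base_injective : Function.Injective (algebraMap (Base n k) (Poly n k)) :=
  Subtype.val_injective

theorem shift_mem_even (a : Base n k) : shift n k (algebraMap _ _ a) ∈ evenSubalgebra n k := a.2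

namespace Base

variable (n k) in
/-- The parameter `t`. -/
protected def t : Base n k := TwistedRing.t n k

variable (k) in
/-- The element `f i = (u i) ^ 2`. -/
protected def f (i : Fin n) : Base n k := TwistedRing.f k i

variable (k) in
/-- The element `y i j = u i + t ^ j s (i, j)`. -/
protected def y (i : Fin n) (j : ℕ) : Base n k := TwistedRing.y k i j

@[simp]
theorem coe_t : algebraMap (Base n k) (Poly n k) (Base.t n k) = C Polynomial.X := rfl

@[simp]
theorem coe_f (i : Fin n) : algebraMap (Base n k) (Poly n k) (Base.f k i) = X (Sum.inl i) ^ 2 :=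
  rfl

@[simp]
theorem coe_y (i : Fin n) (j : ℕ) : algebraMap (Base n k) (Poly n k) (Base.y k i j) =
    X (Sum.inl i) + C Polynomial.X ^ j * X (Sum.inr (i, j)) := rfl

theorem dvd_of_coe_eq (a : Base n k) (w : Poly n k)
    (h : algebraMap (Base n k) (Poly n k) a = C Polynomial.X * w) : Base.t n k ∣ a := by
  have hw : w ∈ A₀ n k := by
    apply mem_A₀_of_t_mul
    rw [← h]
    exact a.2
  exact ⟨(⟨w, hw⟩ : A₀ n k), algebraMap_base_injective h⟩

theorem pow_dvd_of_coe_eq (j : ℕ) (a : Base n k) (w : Poly n k)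
    (h : algebraMap (Base n k) (Poly n k) a = C Polynomial.X ^ j * w) : Base.t n k ^ j ∣ a := by
  induction j generalizing a w with
  | zero => simp
  | succ j ih =>
    obtain ⟨b, rfl⟩ := dvd_of_coe_eq a (C Polynomial.X ^ j * w) (by rw [h]; ring)
    rw [pow_succ']
    refine mul_dvd_mul_left _ (ih b w ?_)
    apply mul_left_cancel₀ (a := C Polynomial.X) (by
      rw [← TwistedRing.coe_t]; exact coe_t_ne_zero)
    rw [← coe_t, ← map_mul, h, coe_t]
    ring

theorem exists_eq_add (w : Poly n k) :
    ∃ b : Base n k, ∃ w' : Poly n k, w = algebraMap (Base n k) (Poly n k) b + C Polynomial.X * w' :=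
  exists_eq_add_t_smul w

end Base

variable (n k) in
/-- The inclusion `k[s] → k[t][u, s]`. -/
def parsToPoly : MvPolynomial (Fin n × ℕ) k →+* Poly n k :=
  eval₂Hom (C.comp Polynomial.C) (fun p ↦ X (Sum.inr p))

theorem residue_parsToPoly (a : MvPolynomial (Fin n × ℕ) k) :
    residue n k (parsToPoly n k a) = algebraMap _ _ a := by
  suffices (residue n k).comp (parsToPoly n k) = algebraMap _ _ from congr($this a)
  apply MvPolynomial.ringHom_ext
  · intro r; simp [parsToPoly]
  · intro r; simp [parsToPoly]

variable (n k) in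
/-- The inclusion of `k(s)` in the localization of `k[t][u, s]` at `(t, u)`. -/
def coeffField : ResField n k →+* RegW n k :=
  IsLocalization.lift (M := nonZeroDivisors (MvPolynomial (Fin n × ℕ) k))
    (g := (algebraMap (Poly n k) (RegW n k)).comp (parsToPoly n k)) <| by
    rintro ⟨a, ha⟩
    refine IsLocalization.map_units (M := (primeW n k).primeCompl) _ ⟨parsToPoly n k a, ?_⟩
    intro h
    have h : residue n k (parsToPoly n k a) = 0 := h
    rw [residue_parsToPoly] at h
    exact nonZeroDivisors.ne_zero ha (by simpa using h)

theorem coeffField_algebraMap (a : MvPolynomial (Fin n × ℕ) k) :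
    coeffField n k (algebraMap _ _ a) = algebraMap _ _ (parsToPoly n k a) :=
  IsLocalization.lift_eq _ _

instance : IsNoetherianRing (RegW n k) := by
  refine IsNoetherianRing.of_localization_factor (R := RegW n k) (primeW n k).primeCompl
    (S := MvPolynomial (Option (Fin n)) (ResField n k))
    (eval₂Hom (Polynomial.eval₂RingHom
      (C.comp ((algebraMap (MvPolynomial (Fin n × ℕ) k) (ResField n k)).comp C)) (X none))
      (Sum.elim (fun i ↦ X (some i)) (fun p ↦ C (algebraMap (MvPolynomial (Fin n × ℕ) k) _ (X p)))))
    (eval₂Hom (coeffField n k) fun o ↦ algebraMap (Poly n k) _ (o.elim (C Polynomial.X)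
      (fun i ↦ X (Sum.inl i)))) ?_
  apply MvPolynomial.ringHom_ext'
  · apply Polynomial.ringHom_ext
    · intro a
      simp [coeffField_algebraMap, parsToPoly]
    · simp
  · rintro (i | p)
    · simp
    · simp [coeffField_algebraMap, parsToPoly]

variable (n k) in
/-- The inclusion of local rings. -/
def locMap : RegA n k →+* RegW n k :=
  Localization.localRingHom (primeA n k) (primeW n k) (algebraMap (Base n k) (Poly n k)) rfl

instance : IsNoetherianRing (RegA n k) := by
  have hflat : RingHom.Flat (R := Base n k) (S := Poly n k) (algebraMap _ _) :=
    RingHom.flat_algebraMap_iff.2 inferInstance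
  have hloc : RingHom.Flat (R := RegA n k) (S := RegW n k) (locMap n k) :=
    RingHom.Flat.localRingHom hflat (primeW n k) (primeA n k) rfl
  have hl : IsLocalHom (locMap n k) :=
    Localization.isLocalHom_localRingHom (primeA n k) (primeW n k) _ rfl
  exact IsNoetherianRing.of_flat_of_isLocalHom (A := RegA n k) (R := RegW n k) _ hloc hl

instance : IsDomain (RegA n k) :=
  IsLocalization.isDomain_localization (primeA n k).primeCompl_le_nonZeroDivisors

theorem primeW_eq : primeW n k =
    Ideal.span (Set.range fun o : Option (Fin n) ↦ o.elim (C Polynomial.X) fun i ↦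
      X (Sum.inl i)) := by
  set J : Ideal (Poly n k) := Ideal.span (Set.range fun o : Option (Fin n) ↦
    o.elim (C Polynomial.X) fun i ↦ X (Sum.inl i)) with hJ
  have hJle : J ≤ primeW n k := by
    rw [hJ, Ideal.span_le]
    rintro _ ⟨_ | i, rfl⟩ <;> simp [mem_primeW]
  have key (w : Poly n k) : ∃ a, w - parsToPoly n k a ∈ J := by
    induction w using MvPolynomial.induction_on with
    | C a =>
      refine ⟨C (a.eval 0), ?_⟩
      obtain ⟨q, hq⟩ := Polynomial.X_dvd_sub_C (p := a)
      have : C a - parsToPoly n k (C (a.eval 0)) = C q * C Polynomial.X := by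
        simp only [parsToPoly, coe_eval₂Hom, eval₂_C, RingHom.comp_apply]
        rw [← C_mul, ← C_sub, ← Polynomial.coeff_zero_eq_eval_zero, hq, mul_comm]
      rw [this]
      exact J.mul_mem_left _ (Ideal.subset_span ⟨none, rfl⟩)
    | add p q hp hq =>
      obtain ⟨a, ha⟩ := hp
      obtain ⟨b, hb⟩ := hq
      refine ⟨a + b, ?_⟩
      rw [map_add, add_sub_add_comm]
      exact J.add_mem ha hb
    | mul_X p v hp =>
      obtain ⟨a, ha⟩ := hp
      rcases v with i | q
      · refine ⟨0, ?_⟩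
        rw [map_zero, sub_zero]
        exact J.mul_mem_left _ (Ideal.subset_span ⟨some i, rfl⟩)
      · refine ⟨a * X q, ?_⟩
        have : parsToPoly n k (X q) = X (Sum.inr q) := by simp [parsToPoly]
        rw [map_mul, this, ← sub_mul]
        exact J.mul_mem_right _ ha
  refine le_antisymm (fun w hw ↦ ?_) hJle
  obtain ⟨a, ha⟩ := key w
  have h1 := mem_primeW.1 (hJle ha)
  rw [map_sub, mem_primeW.1 hw, zero_sub, neg_eq_zero, residue_parsToPoly,
    FaithfulSMul.algebraMap_eq_zero_iff] at h1
  rwa [h1, map_zero, sub_zero] at ha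

variable (n k) in
/-- The generators `t` and `y i 1` of the contraction of `(t, u)`. -/
def gens (o : Option (Fin n)) : Base n k := o.elim (Base.t n k) fun i ↦ Base.y k i 1

theorem primeA_eq : primeA n k = Ideal.span (Set.range (gens n k)) := by
  apply le_antisymm
  · intro a ha
    have key (w : Poly n k) (hw : w ∈ primeW n k) : ∃ b ∈ Ideal.span (Set.range (gens n k)),
        ∃ w', w = algebraMap (Base n k) (Poly n k) b + C Polynomial.X * w' := by
      rw [primeW_eq] at hw
      induction hw using Submodule.span_induction with
      | mem x hx =>
        obtain ⟨_ | i, rfl⟩ := hx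
        · exact ⟨0, zero_mem _, 1, by simp⟩
        · exact ⟨_, Ideal.subset_span ⟨some i, rfl⟩, -X (Sum.inr (i, 1)), by
            simp only [gens, Option.elim, Base.coe_y]; ring⟩
      | zero => exact ⟨0, zero_mem _, 0, by simp⟩
      | add x y _ _ hx hy =>
        obtain ⟨b, hb, w, rfl⟩ := hx
        obtain ⟨c, hc, v, rfl⟩ := hy
        exact ⟨b + c, add_mem hb hc, w + v, by rw [map_add]; ring⟩
      | smul r x _ hx =>
        obtain ⟨b, hb, w, rfl⟩ := hx
        obtain ⟨c, v, rfl⟩ := Base.exists_eq_add r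
        refine ⟨c * b, Ideal.mul_mem_left _ _ hb, algebraMap _ _ c * w + v *
          (algebraMap (Base n k) (Poly n k) b + C Polynomial.X * w), ?_⟩
        rw [map_mul, smul_eq_mul]
        ring
    obtain ⟨b, hb, w, hw⟩ := key _ ha
    obtain ⟨c, hc⟩ := Base.dvd_of_coe_eq (a - b) w (by rw [map_sub, hw]; ring)
    rw [sub_eq_iff_eq_add.1 hc]
    exact add_mem (Ideal.mul_mem_right _ _ (Ideal.subset_span ⟨none, rfl⟩)) hb
  · rw [Ideal.span_le]
    rintro _ ⟨_ | i, rfl⟩ <;> simp [mem_primeA, gens]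

theorem gens_injective : Function.Injective (gens n k) := by
  intro a b h
  have h1 := congr(aeval (R := Polynomial k) (Sum.elim (X : Fin n → MvPolynomial (Fin n)
    (Polynomial k)) fun _ ↦ 0) (algebraMap (Base n k) (Poly n k) $h))
  have hne (i : Fin n) : C Polynomial.X ≠ (X i : MvPolynomial (Fin n) (Polynomial k)) := by
    intro h
    have := congr(totalDegree $h)
    simp at this
  rcases a with _ | i <;> rcases b with _ | j
  · rfl
  · simp [gens, algebraMap_eq] at h1
    exact (hne j h1).elim
  · simp [gens, algebraMap_eq] at h1
    exact (hne i h1.symm).elim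
  · simp [gens] at h1
    rw [h1]

theorem algebraMap_regA_injective : Function.Injective (algebraMap (Base n k) (RegA n k)) :=
  IsLocalization.injective _ (primeA n k).primeCompl_le_nonZeroDivisors

theorem maximalIdeal_eq : IsLocalRing.maximalIdeal (RegA n k) =
    Ideal.span (Set.range fun o ↦ algebraMap (Base n k) (RegA n k) (gens n k o)) := by
  rw [← Localization.AtPrime.map_eq_maximalIdeal, congr(Ideal.map _ $primeA_eq), Ideal.map_span,
    ← Set.range_comp]
  rfl

theorem exists_finset_span_eq_maximalIdeal : ∃ s : Finset (RegA n k), s.card = n + 1 ∧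
    Ideal.span (s : Set (RegA n k)) = IsLocalRing.maximalIdeal (RegA n k) := by
  classical
  refine ⟨Finset.univ.image fun o ↦ algebraMap (Base n k) (RegA n k) (gens n k o), ?_, ?_⟩
  · have := Finset.card_image_of_injective (Finset.univ : Finset (Option (Fin n)))
      (algebraMap_regA_injective.comp (gens_injective (k := k)))
    simpa [Function.comp_def] using this
  · rw [maximalIdeal_eq]; simp

variable (n k) in
/-- The endomorphism of `k[t][u, s]` killing the `u i` with `i < j`. -/
def kill (j : ℕ) : Poly n k →+* Poly n k :=
  (aeval (R := Polynomial k) (Sum.elim (fun i ↦ if i.val < j then 0 else X (Sum.inl i))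
    (fun p ↦ X (Sum.inr p)) : Vars n → Poly n k)).toRingHom

@[simp]
theorem kill_C (j : ℕ) (a : Polynomial k) : kill n k j (C a) = C a := by
  simp [kill, algebraMap_eq]

@[simp]
theorem kill_inl (j : ℕ) (i : Fin n) :
    kill n k j (X (Sum.inl i)) = if i.val < j then 0 else X (Sum.inl i) := by
  simp [kill]

@[simp]
theorem kill_inr (j : ℕ) (p : Fin n × ℕ) : kill n k j (X (Sum.inr p)) = X (Sum.inr p) := by
  simp [kill]

theorem kill_succ_kill (j : ℕ) (w : Poly n k) : kill n k (j + 1) (kill n k j w) =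
    kill n k (j + 1) w := by
  suffices (kill n k (j + 1)).comp (kill n k j) = kill n k (j + 1) from congr($this w)
  apply MvPolynomial.ringHom_ext
  · intro r; simp
  · rintro (i | p)
    · by_cases h : i.val < j
      · simp [h, h.trans (Nat.lt_succ_self j)]
      · simp [h]
    · simp

theorem residue_kill (j : ℕ) (w : Poly n k) : residue n k (kill n k j w) = residue n k w := by
  suffices (residue n k).comp (kill n k j) = residue n k from congr($this w)
  apply MvPolynomial.ringHom_ext
  · intro r; simp
  · rintro (i | p)
    · by_cases h : i.val < j <;> simp [h]
    · simp

variable (n k) in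
/-- The contraction of the prime generated by the `u i` with `i < j`. -/
def chain (j : ℕ) : Ideal (Base n k) :=
  RingHom.ker ((kill n k j).comp (algebraMap (Base n k) (Poly n k)))

instance (j : ℕ) : (chain n k j).IsPrime := RingHom.ker_isPrime _

theorem mem_chain {j : ℕ} {a : Base n k} :
    a ∈ chain n k j ↔ kill n k j (algebraMap _ _ a) = 0 := Iff.rfl

theorem chain_lt_succ {j : ℕ} (hj : j < n) : chain n k j < chain n k (j + 1) := by
  refine lt_of_le_of_ne (fun a ha ↦ ?_) fun h ↦ ?_
  · rw [mem_chain] at ha ⊢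
    rw [← kill_succ_kill, ha, map_zero]
  · have : Base.f k ⟨j, hj⟩ ∈ chain n k (j + 1) := by simp [mem_chain]
    rw [← h] at this
    simp [mem_chain] at this

theorem le_height_chain {j : ℕ} (hj : j ≤ n) : (j : ℕ∞) ≤ (chain n k j).height := by
  induction j with
  | zero => simp
  | succ j ih =>
    refine le_trans ?_ (Ideal.height_add_one_le_of_lt_of_isPrime (chain_lt_succ hj))
    push_cast
    gcongr
    exact ih (Nat.le_of_lt hj)

theorem chain_lt_primeA (j : ℕ) : chain n k j < primeA n k := by
  refine lt_of_le_of_ne (fun a ha ↦ ?_) fun h ↦ ?_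
  · rw [mem_primeA, ← residue_kill j, mem_chain.1 ha, map_zero]
  · have : Base.t n k ∈ primeA n k := by simp [mem_primeA]
    rw [← h] at this
    simp [mem_chain] at this

theorem le_height_primeA : ((n + 1 : ℕ) : ℕ∞) ≤ (primeA n k).height := by
  refine le_trans ?_ (Ideal.height_add_one_le_of_lt_of_isPrime (chain_lt_primeA n))
  push_cast
  gcongr
  exact le_height_chain le_rfl

theorem ringKrullDim_regA : ringKrullDim (RegA n k) = (n + 1 : ℕ) := by
  apply le_antisymm
  · obtain ⟨s, hs, hs'⟩ := exists_finset_span_eq_maximalIdeal (n := n) (k := k)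
    rw [← IsLocalRing.maximalIdeal_height_eq_ringKrullDim]
    have : (IsLocalRing.maximalIdeal (RegA n k)).height ≤ s.card :=
      Ideal.height_le_card_of_mem_minimalPrimes_span_finset (by
        rw [hs', Ideal.minimalPrimes_eq_subsingleton_self]; rfl)
    rw [hs] at this
    exact_mod_cast this
  · rw [IsLocalization.AtPrime.ringKrullDim_eq_height (primeA n k) (RegA n k)]
    exact_mod_cast le_height_primeA

variable (n k) in
/-- The prime whose extension to the completion is not integrally closed. -/
def primeP : Ideal (RegA n k) := (chain n k n).map (algebraMap (Base n k) (RegA n k))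

theorem disjoint_chain (j : ℕ) :
    Disjoint ((primeA n k).primeCompl : Set (Base n k)) (chain n k j) :=
  Set.disjoint_left.2 fun _ h h' ↦ h ((chain_lt_primeA j).le h')

instance : (primeP n k).IsPrime :=
  IsLocalization.isPrime_of_isPrime_disjoint (primeA n k).primeCompl (RegA n k) _ inferInstance
    (disjoint_chain n)

theorem height_primeP : (primeP n k).height = n := by
  apply le_antisymm
  · have h : primeP n k < IsLocalRing.maximalIdeal (RegA n k) := by
      refine lt_of_le_of_ne (IsLocalRing.le_maximalIdeal Ideal.IsPrime.ne_top') fun h ↦ ?_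
      have h1 := IsLocalization.under_map_of_isPrime_disjoint (primeA n k).primeCompl (RegA n k)
        (inferInstanceAs (chain n k n).IsPrime) (disjoint_chain n)
      have h2 := IsLocalization.AtPrime.under_maximalIdeal (RegA n k) (primeA n k)
      rw [← h] at h2
      exact (chain_lt_primeA n).ne (h1.symm.trans h2)
    have h1 := Ideal.height_add_one_le_of_lt_of_isPrime h
    have h2 : ((IsLocalRing.maximalIdeal (RegA n k)).height : WithBot ℕ∞) = (n + 1 : ℕ) := by
      rw [IsLocalRing.maximalIdeal_height_eq_ringKrullDim, ringKrullDim_regA]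
    have h3 : (IsLocalRing.maximalIdeal (RegA n k)).height = n + 1 := by exact_mod_cast h2
    rw [h3] at h1
    exact (ENat.add_le_add_iff_right ENat.one_ne_top).1 h1
  · rw [primeP, IsLocalization.height_map_of_disjoint (primeA n k).primeCompl _ (disjoint_chain n)]
    exact le_height_chain le_rfl

theorem mem_span_inl_of_kill_eq_zero {w : Poly n k} (h : kill n k n w = 0) :
    w ∈ Ideal.span (X '' Set.range (Sum.inl : Fin n → Vars n)) := by
  set J : Ideal (Poly n k) := Ideal.span (X '' Set.range (Sum.inl : Fin n → Vars n))
  suffices ∀ w, w - kill n k n w ∈ J by simpa [h] using this w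
  intro w
  induction w using MvPolynomial.induction_on with
  | C a => simp
  | add p q hp hq => rw [map_add, add_sub_add_comm]; exact add_mem hp hq
  | mul_X p v hp =>
    rcases v with i | q
    · rw [map_mul, kill_inl, if_pos i.2, mul_zero, sub_zero]
      exact J.mul_mem_left _ (Ideal.subset_span ⟨_, ⟨i, rfl⟩, rfl⟩)
    · rw [map_mul, kill_inr, ← sub_mul]
      exact J.mul_mem_right _ hp

/-- The exponents of the monomials `(u i) ^ 2`. -/
abbrev sqExps (n : ℕ) : Set (Vars n →₀ ℕ) :=
  Set.range fun i : Fin n ↦ Finsupp.single (Sum.inl i) 2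

theorem mem_span_sq_of_kill_eq_zero {a : Base n k} (h : kill n k n (algebraMap _ _ a) = 0) :
    algebraMap (Base n k) (Poly n k) a ∈
      Ideal.span ((fun m ↦ monomial m (1 : Polynomial k)) '' sqExps n) := by
  have h1 := Ideal.mem_map_of_mem (shift n k) (mem_span_inl_of_kill_eq_zero h)
  have h2 : Ideal.map (shift n k) (Ideal.span (X '' Set.range (Sum.inl : Fin n → Vars n))) =
      Ideal.span (X '' Set.range (Sum.inl : Fin n → Vars n)) := by
    rw [Ideal.map_span, Set.image_image, ← Set.range_comp, ← Set.range_comp]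
    congr! 2
    ext1 i
    simp
  rw [h2, mem_ideal_span_X_image] at h1
  have h3 : shift n k (algebraMap (Base n k) (Poly n k) a) ∈ Ideal.span ((fun m ↦ monomial m
      (1 : FractionRing (Polynomial k))) '' sqExps n) := by
    rw [mem_ideal_span_monomial_image]
    intro m hm
    obtain ⟨_, ⟨i, rfl⟩, hi⟩ := h1 m hm
    refine ⟨_, ⟨i, rfl⟩, ?_⟩
    rw [Finsupp.single_le_iff]
    have := shift_mem_even a m (mem_support_iff.1 hm) i
    grind
  have h4 := Ideal.mem_map_of_mem (unshift n k) h3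
  have h5 : Ideal.map (unshift n k) (Ideal.span ((fun m ↦ monomial m
      (1 : FractionRing (Polynomial k))) '' sqExps n)) = Ideal.span ((fun m ↦ monomial m
      (1 : FractionRing (Polynomial k))) '' sqExps n) := by
    rw [Ideal.map_span, Set.image_image, ← Set.range_comp, ← Set.range_comp]
    congr! 2
    ext1 i
    simp [unshift, ← X_pow_eq_monomial]
  rw [h5, unshift_shift, mem_ideal_span_monomial_image,
    support_map_of_injective _ (IsFractionRing.injective (Polynomial k) _)] at h4
  rwa [mem_ideal_span_monomial_image]

/-- The ring `K[ε₁, ε₂]` of iterated dual numbers. -/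
def DualSq (K : Type*) [Field K] : Type _ := DualNumber (DualNumber K)

namespace DualSq

variable {K : Type*} [Field K]

instance : CommRing (DualSq K) := inferInstanceAs (CommRing (DualNumber (DualNumber K)))

/-- The residue map of the iterated dual numbers. -/
def res : DualSq K →+* K :=
  (TrivSqZeroExt.fstHom K K K).toRingHom.comp
    (TrivSqZeroExt.fstHom (DualNumber K) (DualNumber K) (DualNumber K)).toRingHom

/-- The inclusion of the scalars in the iterated dual numbers. -/
def const : K →+* DualSq K :=
  (TrivSqZeroExt.inlHom (DualNumber K) (DualNumber K)).comp (TrivSqZeroExt.inlHom K K)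

/-- The inner square-zero element. -/
def eps₁ : DualSq K := (TrivSqZeroExt.inl DualNumber.eps : DualNumber (DualNumber K))

/-- The outer square-zero element. -/
def eps₂ : DualSq K := (DualNumber.eps : DualNumber (DualNumber K))

@[simp]
theorem res_const (x : K) : res (const x) = x := rfl

@[simp]
theorem res_eps₁ : res (eps₁ : DualSq K) = 0 := rfl

@[simp]
theorem res_eps₂ : res (eps₂ : DualSq K) = 0 := rfl

@[simp]
theorem eps₁_mul_self : (eps₁ * eps₁ : DualSq K) = 0 := by
  have : (TrivSqZeroExt.inl DualNumber.eps * TrivSqZeroExt.inl DualNumber.eps :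
      DualNumber (DualNumber K)) = 0 := by
    rw [← TrivSqZeroExt.inl_mul, DualNumber.eps_mul_eps, TrivSqZeroExt.inl_zero]
  exact this

@[simp]
theorem eps₂_mul_self : (eps₂ * eps₂ : DualSq K) = 0 :=
  DualNumber.eps_mul_eps (R := DualNumber K)

theorem eps₁_mul_eps₂_ne_zero : (eps₁ * eps₂ : DualSq K) ≠ 0 := by
  intro h
  have h1 : (TrivSqZeroExt.inl DualNumber.eps * DualNumber.eps : DualNumber (DualNumber K)) = 0 := h
  have := congr(($h1).snd.snd)
  simp at this

theorem isUnit_of_res_ne_zero {x : DualSq K} (h : res x ≠ 0) : IsUnit x :=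
  TrivSqZeroExt.isUnit_iff_isUnit_fst.2 (TrivSqZeroExt.isUnit_iff_isUnit_fst.2 h.isUnit)

theorem mul_mul_eq_zero {a b c : DualSq K} (ha : res a = 0) (hb : res b = 0) (hc : res c = 0) :
    a * b * c = 0 := by
  have key (a b c : DualNumber (DualNumber K)) (ha : a.fst.fst = 0) (hb : b.fst.fst = 0)
      (hc : c.fst.fst = 0) : a * b * c = 0 := by
    ext <;> simp [ha, hb, hc]
  exact key a b c ha hb hc

theorem ker_res_pow_three : RingHom.ker (res (K := K)) ^ 3 = ⊥ := by
  rw [eq_bot_iff, pow_succ, Ideal.mul_le]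
  intro x hx c hc
  rw [sq] at hx
  induction hx using Submodule.mul_induction_on' with
  | mem_mul_mem a ha b hb => exact mul_mul_eq_zero ha hb hc
  | add x _ y _ hx hy => rw [add_mul]; exact add_mem hx hy

end DualSq

variable (k) in
/-- The map sending `u i₀`, `u i₁` to `ε₁`, `ε₂`, and killing `t` and the other `u i`. -/
def testPoly (i₀ i₁ : Fin n) : Poly n k →+* DualSq (ResField n k) :=
  eval₂Hom (DualSq.const.comp (((algebraMap (MvPolynomial (Fin n × ℕ) k) (ResField n k)).comp
      C).comp (Polynomial.evalRingHom 0)))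
    (Sum.elim (fun i ↦ if i = i₀ then DualSq.eps₁ else if i = i₁ then DualSq.eps₂ else 0)
      fun p ↦ DualSq.const (algebraMap (MvPolynomial (Fin n × ℕ) k) (ResField n k) (X p)))

theorem testPoly_C_X (i₀ i₁ : Fin n) : testPoly k i₀ i₁ (C Polynomial.X) = 0 := by
  simp [testPoly]

theorem testPoly_inl (i₀ i₁ i : Fin n) : testPoly k i₀ i₁ (X (Sum.inl i)) =
    if i = i₀ then DualSq.eps₁ else if i = i₁ then DualSq.eps₂ else 0 := by
  simp [testPoly]

theorem res_testPoly (i₀ i₁ : Fin n) (w : Poly n k) :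
    DualSq.res (testPoly k i₀ i₁ w) = residue n k w := by
  suffices DualSq.res.comp (testPoly k i₀ i₁) = residue n k from congr($this w)
  apply MvPolynomial.ringHom_ext
  · intro r; simp [testPoly]
  · rintro (i | p)
    · simp only [RingHom.comp_apply, testPoly_inl, residue_inl]
      split_ifs <;> simp
    · simp [testPoly]

theorem testPoly_eq_zero (i₀ i₁ : Fin n) {a : Base n k} (h : a ∈ chain n k n) :
    testPoly k i₀ i₁ (algebraMap _ _ a) = 0 := by
  suffices Ideal.span ((fun m ↦ monomial m (1 : Polynomial k)) '' sqExps n) ≤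
      RingHom.ker (testPoly k i₀ i₁) from this (mem_span_sq_of_kill_eq_zero (mem_chain.1 h))
  rw [Ideal.span_le]
  rintro _ ⟨_, ⟨i, rfl⟩, rfl⟩
  simp only [← X_pow_eq_monomial, SetLike.mem_coe, RingHom.mem_ker, sq, map_mul, testPoly_inl]
  split_ifs <;> simp

variable (k) in
/-- The extension of `testPoly` to the local ring. -/
def test (i₀ i₁ : Fin n) : RegA n k →+* DualSq (ResField n k) :=
  IsLocalization.lift (M := (primeA n k).primeCompl)
    (g := (testPoly k i₀ i₁).comp (algebraMap (Base n k) (Poly n k))) <| by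
    rintro ⟨a, ha⟩
    apply DualSq.isUnit_of_res_ne_zero
    rw [RingHom.comp_apply, res_testPoly]
    exact ha

theorem test_algebraMap (i₀ i₁ : Fin n) (a : Base n k) :
    test k i₀ i₁ (algebraMap _ _ a) = testPoly k i₀ i₁ (algebraMap _ _ a) :=
  IsLocalization.lift_eq _ _

theorem test_eq_zero_of_mem_primeP (i₀ i₁ : Fin n) {a : RegA n k} (h : a ∈ primeP n k) :
    test k i₀ i₁ a = 0 := by
  suffices primeP n k ≤ RingHom.ker (test k i₀ i₁) from this h
  rw [primeP, Ideal.map_le_iff_le_comap]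
  intro b hb
  exact (test_algebraMap i₀ i₁ b).trans (testPoly_eq_zero i₀ i₁ hb)

theorem test_eq_zero_of_mem_pow (i₀ i₁ : Fin n) {a : RegA n k}
    (h : a ∈ IsLocalRing.maximalIdeal (RegA n k) ^ 3) : test k i₀ i₁ a = 0 := by
  have h1 : (IsLocalRing.maximalIdeal (RegA n k)).map (test k i₀ i₁) ≤ RingHom.ker DualSq.res := by
    rw [← Localization.AtPrime.map_eq_maximalIdeal, Ideal.map_map, Ideal.map_le_iff_le_comap]
    intro b hb
    have : DualSq.res (test k i₀ i₁ (algebraMap _ _ b)) = 0 := by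
      rw [test_algebraMap, res_testPoly]; exact hb
    exact this
  have h2 := Ideal.mem_map_of_mem (test k i₀ i₁) h
  rw [Ideal.map_pow] at h2
  have h3 := Ideal.pow_right_mono h1 3 h2
  rw [DualSq.ker_res_pow_three] at h3
  exact h3

theorem test_y_mul_y_ne_zero {i₀ i₁ : Fin n} (h : i₁ ≠ i₀) {j : ℕ} (hj : j ≠ 0) :
    test k i₀ i₁ (algebraMap _ _ (Base.y k i₀ j * Base.y k i₁ j)) ≠ 0 := by
  rw [test_algebraMap]
  simp only [map_mul, Base.coe_y, map_add, map_pow, testPoly_C_X, testPoly_inl, zero_pow hj, h,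
    if_true, if_false, zero_mul, add_zero]
  exact DualSq.eps₁_mul_eps₂_ne_zero

end TwistedRing

/-- The square roots of `a` and `b` in the completion, approximated by `x` and `y`, have a product
that is integral over the extension of `P`, and `φ` detects that it is not in that extension. -/
theorem not_isIntegrallyClosedIdeal_map_adicCompletion {A S : Type*} [CommRing A] [CommRing S]
    {m P : Ideal A} {a b : A} (ha : a ∈ P) (hb : b ∈ P) {x y : ℕ → A}
    (hx : ∀ j, x j - x (j + 1) ∈ m ^ j) (hy : ∀ j, y j - y (j + 1) ∈ m ^ j)
    (hxa : ∀ j, x j ^ 2 - a ∈ m ^ j) (hyb : ∀ j, y j ^ 2 - b ∈ m ^ j) {N : ℕ} (φ : A →+* S)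
    (hP : ∀ c ∈ P, φ c = 0) (hm : ∀ c ∈ m ^ N, φ c = 0) (hφ : φ (x N * y N) ≠ 0) :
    ¬ IsIntegrallyClosedIdeal (P.map (algebraMap A (AdicCompletion m A))) := by
  intro h
  have cauchy {z : ℕ → A} (hz : ∀ j, z j - z (j + 1) ∈ m ^ j) (j : ℕ) :
      z j ≡ z (j + 1) [SMOD (m ^ j • ⊤ : Submodule A A)] := by
    rw [SModEq.sub_mem, smul_eq_mul, Ideal.mul_top]
    exact hz j
  set X : AdicCompletion m A := AdicCompletion.mk m A (.mk m A x (cauchy hx))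
  set Y : AdicCompletion m A := AdicCompletion.mk m A (.mk m A y (cauchy hy))
  have evX (j : ℕ) : AdicCompletion.evalₐ m j X = Ideal.Quotient.mk _ (x j) :=
    AdicCompletion.evalₐ_mk _ _ _
  have evY (j : ℕ) : AdicCompletion.evalₐ m j Y = Ideal.Quotient.mk _ (y j) :=
    AdicCompletion.evalₐ_mk _ _ _
  have ev (j : ℕ) (c : A) : AdicCompletion.evalₐ m j (algebraMap A _ c) = Ideal.Quotient.mk _ c :=
    (AdicCompletion.evalₐ m j).commutes c
  have sqX : X ^ 2 = algebraMap A _ a := AdicCompletion.ext_evalₐ fun j ↦ by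
    rw [map_pow, evX, ev, ← map_pow]
    exact Ideal.Quotient.eq.2 (hxa j)
  have sqY : Y ^ 2 = algebraMap A _ b := AdicCompletion.ext_evalₐ fun j ↦ by
    rw [map_pow, evY, ev, ← map_pow]
    exact Ideal.Quotient.eq.2 (hyb j)
  have hint : IsIntegralOverIdeal (P.map (algebraMap A (AdicCompletion m A))) (X * Y) := by
    refine ⟨2, two_pos, fun i ↦ if i = 2 then -(algebraMap A _ a * algebraMap A _ b) else 0,
      fun i _ ↦ ?_, ?_⟩
    · by_cases hi : i = 2
      · subst hi
        beta_reduce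
        rw [if_pos rfl, sq]
        exact neg_mem (Ideal.mul_mem_mul (Ideal.mem_map_of_mem _ ha) (Ideal.mem_map_of_mem _ hb))
      · beta_reduce
        rw [if_neg hi]
        exact zero_mem _
    · rw [Finset.sum_eq_single 2 (fun i _ hi ↦ by beta_reduce; rw [if_neg hi, zero_mul]) (by simp)]
      beta_reduce
      rw [if_pos rfl, ← sqX, ← sqY]
      ring
  let ψ : A ⧸ m ^ N →+* S := Ideal.Quotient.lift (m ^ N) φ hm
  have hker : P.map (algebraMap A (AdicCompletion m A)) ≤
      RingHom.ker (ψ.comp (AdicCompletion.evalₐ m N).toRingHom) := by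
    rw [Ideal.map_le_iff_le_comap]
    intro c hc
    change ψ (AdicCompletion.evalₐ m N (algebraMap A _ c)) = 0
    rw [ev]
    exact hP c hc
  have h0 : ψ (AdicCompletion.evalₐ m N (X * Y)) = 0 := hker (h _ hint)
  rw [map_mul, evX, evY, ← map_mul] at h0
  exact hφ h0

namespace TwistedRing

open MvPolynomial

variable {n : ℕ} {k : Type} [Field k]

theorem algebraMap_mem_maximalIdeal_pow {j : ℕ} {a : Base n k} (h : Base.t n k ^ j ∣ a) :
    algebraMap (Base n k) (RegA n k) a ∈ IsLocalRing.maximalIdeal (RegA n k) ^ j := by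
  obtain ⟨c, rfl⟩ := h
  rw [map_mul, map_pow]
  refine Ideal.mul_mem_right _ _ (Ideal.pow_mem_pow ?_ _)
  rw [maximalIdeal_eq]
  exact Ideal.subset_span ⟨none, rfl⟩

theorem y_sub_mem (i : Fin n) (j : ℕ) : algebraMap (Base n k) (RegA n k) (Base.y k i j) -
    algebraMap (Base n k) (RegA n k) (Base.y k i (j + 1)) ∈
      IsLocalRing.maximalIdeal (RegA n k) ^ j := by
  rw [← map_sub]
  apply algebraMap_mem_maximalIdeal_pow
  apply Base.pow_dvd_of_coe_eq _ _ (X (Sum.inr (i, j)) - C Polynomial.X * X (Sum.inr (i, j + 1)))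
  rw [map_sub, Base.coe_y, Base.coe_y]
  ring

theorem y_sq_sub_mem (i : Fin n) (j : ℕ) : algebraMap (Base n k) (RegA n k) (Base.y k i j) ^ 2 -
    algebraMap (Base n k) (RegA n k) (Base.f k i) ∈ IsLocalRing.maximalIdeal (RegA n k) ^ j := by
  rw [← map_pow, ← map_sub]
  apply algebraMap_mem_maximalIdeal_pow
  apply Base.pow_dvd_of_coe_eq _ _ (2 * X (Sum.inl i) * X (Sum.inr (i, j)) +
    C Polynomial.X ^ j * X (Sum.inr (i, j)) ^ 2)
  rw [map_sub, map_pow, Base.coe_y, Base.coe_f]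
  ring

theorem f_mem_primeP (i : Fin n) :
    algebraMap (Base n k) (RegA n k) (Base.f k i) ∈ primeP n k :=
  Ideal.mem_map_of_mem _ (by simp [mem_chain])

theorem not_isIntegrallyClosedIdeal_map_primeP {i₀ i₁ : Fin n} (h : i₁ ≠ i₀) :
    ¬ IsIntegrallyClosedIdeal ((primeP n k).map
      (algebraMap (RegA n k) (AdicCompletion (IsLocalRing.maximalIdeal (RegA n k)) (RegA n k)))) :=
  not_isIntegrallyClosedIdeal_map_adicCompletion (f_mem_primeP i₀) (f_mem_primeP i₁)
    (y_sub_mem i₀) (y_sub_mem i₁) (y_sq_sub_mem i₀) (y_sq_sub_mem i₁) (N := 3) (test k i₀ i₁)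
    (fun _ ↦ test_eq_zero_of_mem_primeP i₀ i₁) (fun _ ↦ test_eq_zero_of_mem_pow i₀ i₁) (by
      rw [← map_mul]
      exact test_y_mul_y_ne_zero h three_ne_zero)

end TwistedRing

/-- For every `d ≥ 3` and every field `k` of characteristic zero there is a
`d`-dimensional regular local domain `A` (a `k`-algebra) and a prime ideal `P` of `A` of
height `d - 1` whose extension to the completion of `A` at its maximal ideal is not
integrally closed. -/
theorem exists_regular_local_domain_with_prime_not_integrally_closed_in_completion
    (k : Type) [Field k] [CharZero k] (d : ℕ) (hd : 3 ≤ d) :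
    ∃ (A : Type) (_ : CommRing A) (_ : Algebra k A),
      IsDomain A ∧ IsNoetherianRing A ∧
      ∃ _hl : IsLocalRing A,
        (∃ s : Finset A, s.card = d ∧
          Ideal.span (s : Set A) = IsLocalRing.maximalIdeal A) ∧
        ringKrullDim A = d ∧
        ∃ (P : Ideal A) (hp : P.IsPrime),
          Order.height (⟨P, hp⟩ : PrimeSpectrum A) = (d - 1 : ℕ) ∧
          ¬ IsIntegrallyClosedIdeal
            (Ideal.map (algebraMap A (AdicCompletion (IsLocalRing.maximalIdeal A) A)) P) := by
  obtain ⟨n, rfl⟩ : ∃ n, d = n + 1 := ⟨d - 1, by omega⟩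
  refine ⟨TwistedRing.RegA n k, inferInstance, inferInstance, inferInstance, inferInstance,
    inferInstance, TwistedRing.exists_finset_span_eq_maximalIdeal, TwistedRing.ringKrullDim_regA,
    TwistedRing.primeP n k, inferInstance, ?_, ?_⟩
  · rw [← PrimeSpectrum.height_eq_orderHeight, TwistedRing.height_primeP, Nat.add_sub_cancel]
  · exact TwistedRing.not_isIntegrallyClosedIdeal_map_primeP
      (i₀ := ⟨0, by omega⟩) (i₁ := ⟨1, by omega⟩) (by simp)
end
end

section
/- Let B₁ be the polynomial ring k[x,y,z,u,v] in five indeterminates localized at the maximal ideal (x,y,z,u,v). Then the ideal (xu + y², xv + z²)B₁ is a prime ideal of B₁ of height two. -/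
noncomputable section

open MvPolynomial

/-- The polynomial ring `k[x,y,z,u,v]` in five variables (`x = X 0`, `y = X 1`, `z = X 2`,
`u = X 3`, `v = X 4`). -/
abbrev Q5 (k : Type) [Field k] := MvPolynomial (Fin 5) k

variable (k : Type) [Field k]

/-- The maximal ideal `(x,y,z,u,v)` of `k[x,y,z,u,v]`, realized as the kernel of
evaluation at the origin. -/
def m5 : Ideal (Q5 k) := RingHom.ker (aeval (R := k) (fun _ : Fin 5 => (0 : k))).toRingHom

instance : (m5 k).IsPrime := RingHom.ker_isPrime _

/-- `B₁ = k[x,y,z,u,v]` localized at the maximal ideal `(x,y,z,u,v)`. -/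
abbrev B1 (k : Type) [Field k] := Localization.AtPrime (m5 k)

/-- The ideal `(xu + y², xv + z²)B₁`. -/
def I8 : Ideal (B1 k) :=
  Ideal.span {algebraMap (Q5 k) (B1 k) (X 0 * X 3 + X 1 ^ 2),
    algebraMap (Q5 k) (B1 k) (X 0 * X 4 + X 2 ^ 2)}

/-- The ideal `(xu + y², xv + z²)` of the polynomial ring `k[x,y,z,u,v]`. -/
def polyIdeal : Ideal (Q5 k) :=
  Ideal.span {X 0 * X 3 + X 1 ^ 2, X 0 * X 4 + X 2 ^ 2}

lemma left_mem_polyIdeal : (X 0 * X 3 + X 1 ^ 2 : Q5 k) ∈ polyIdeal k :=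
  Ideal.subset_span (by simp)

lemma right_mem_polyIdeal : (X 0 * X 4 + X 2 ^ 2 : Q5 k) ∈ polyIdeal k :=
  Ideal.subset_span (by simp)

lemma map_polyIdeal : (polyIdeal k).map (algebraMap (Q5 k) (B1 k)) = I8 k := by
  rw [polyIdeal, Ideal.map_span, Set.image_pair, I8]

/-- The substitution `x = 0`. -/
def substXZero : Q5 k →ₐ[k] Q5 k := aeval ![0, X 1, X 2, X 3, X 4]

lemma X_zero_dvd_sub_substXZero (f : Q5 k) : X 0 ∣ f - substXZero k f := by
  rw [← Ideal.mem_span_singleton, ← Ideal.Quotient.mk_eq_mk_iff_sub_mem]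
  have h : Ideal.Quotient.mkₐ k (Ideal.span {(X 0 : Q5 k)}) =
      (Ideal.Quotient.mkₐ k (Ideal.span {(X 0 : Q5 k)})).comp (substXZero k) := by
    ext i
    fin_cases i <;> simp [substXZero]
  exact DFunLike.congr_fun h f

/-- The variable `x` is a nonzerodivisor modulo `(xu + y², xv + z²)`. -/
lemma mem_polyIdeal_of_X_zero_mul_mem {f : Q5 k} (hf : X 0 * f ∈ polyIdeal k) :
    f ∈ polyIdeal k := by
  obtain ⟨a, b, hab⟩ := Ideal.mem_span_pair.mp hf
  obtain ⟨a', ha'⟩ := X_zero_dvd_sub_substXZero k a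
  obtain ⟨b', hb'⟩ := X_zero_dvd_sub_substXZero k b
  have h0 : substXZero k a * X 1 ^ 2 + substXZero k b * X 2 ^ 2 = 0 := by
    have := congrArg (substXZero k) hab
    simpa [substXZero] using this
  have hz : (X 2 : Q5 k) ^ 2 ∣ substXZero k a := by
    refine (X_prime (R := k) (i := (2 : Fin 5))).pow_dvd_of_dvd_mul_right 2 (b := X 1 ^ 2) ?_
      ⟨-substXZero k b, by linear_combination h0⟩
    intro h
    have := X_dvd_X.mp ((X_prime (R := k) (i := (2 : Fin 5))).dvd_of_dvd_pow h)
    exact absurd this (by decide)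
  obtain ⟨c, hc⟩ := hz
  have hb : substXZero k b = -(c * X 1 ^ 2) := by
    have hne : (X 2 ^ 2 : Q5 k) ≠ 0 := pow_ne_zero _ (X_ne_zero _)
    apply mul_right_cancel₀ hne
    linear_combination h0 - X 1 ^ 2 * hc
  refine Ideal.mem_span_pair.mpr ⟨a' - c * X 4, b' + c * X 3, ?_⟩
  apply mul_left_cancel₀ (X_ne_zero (R := k) (0 : Fin 5))
  rw [hc] at ha'
  rw [hb] at hb'
  linear_combination hab - (X 0 * X 3 + X 1 ^ 2) * ha' - (X 0 * X 4 + X 2 ^ 2) * hb'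

lemma mem_polyIdeal_of_X_zero_pow_mul_mem {f : Q5 k} (n : ℕ)
    (hf : X 0 ^ n * f ∈ polyIdeal k) : f ∈ polyIdeal k := by
  induction n with
  | zero => simpa using hf
  | succ n ih =>
    refine ih (mem_polyIdeal_of_X_zero_mul_mem k ?_)
    rwa [← mul_assoc, ← pow_succ']

/-- The substitution `u = -y²/x`, `v = -z²/x`. -/
def substUV : Q5 k →ₐ[k] FractionRing (Q5 k) :=
  let ι := algebraMap (Q5 k) (FractionRing (Q5 k))
  aeval ![ι (X 0), ι (X 1), ι (X 2), -ι (X 1) ^ 2 / ι (X 0), -ι (X 2) ^ 2 / ι (X 0)]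

lemma polyIdeal_le_ker_substUV : polyIdeal k ≤ RingHom.ker (substUV k) := by
  have hx : algebraMap (Q5 k) (FractionRing (Q5 k)) (X 0) ≠ 0 := by
    simp [X_ne_zero]
  rw [polyIdeal, Ideal.span_le]
  rintro _ (rfl | rfl) <;> simp only [SetLike.mem_coe, RingHom.mem_ker] <;>
    simp [substUV] <;> field_simp <;> ring

lemma exists_X_zero_pow_mul_sub_mem (f : Q5 k) :
    ∃ (n : ℕ) (g : Q5 k), substUV k g = algebraMap _ _ g ∧ X 0 ^ n * f - g ∈ polyIdeal k := by
  induction f using MvPolynomial.induction_on with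
  | C a => exact ⟨0, C a, by rw [algHom_C]; rfl, by simp⟩
  | add p q hp hq =>
    obtain ⟨n, g, hg, h⟩ := hp
    obtain ⟨m, g', hg', h'⟩ := hq
    refine ⟨n + m, X 0 ^ m * g + X 0 ^ n * g', ?_, ?_⟩
    · have hx : substUV k (X 0) = algebraMap (Q5 k) _ (X 0) := by simp [substUV]
      simp [hg, hg', hx]
    · convert add_mem (Ideal.mul_mem_left _ (X 0 ^ m) h) (Ideal.mul_mem_left _ (X 0 ^ n) h')
        using 1
      ring
  | mul_X p i hp =>
    obtain ⟨n, g, hg, h⟩ := hp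
    have fixed (i : Fin 5) (hi : substUV k (X i) = algebraMap (Q5 k) _ (X i)) :
        ∃ (n : ℕ) (g : Q5 k), substUV k g = algebraMap _ _ g ∧
          X 0 ^ n * (p * X i) - g ∈ polyIdeal k := by
      refine ⟨n, g * X i, by simp [hg, hi], ?_⟩
      convert Ideal.mul_mem_left _ (X i) h using 1
      ring
    have eliminated (i j : Fin 5) (hj : substUV k (X j) = algebraMap (Q5 k) _ (X j))
        (hij : (X 0 * X i + X j ^ 2 : Q5 k) ∈ polyIdeal k) : ∃ (n : ℕ) (g : Q5 k),
        substUV k g = algebraMap _ _ g ∧ X 0 ^ n * (p * X i) - g ∈ polyIdeal k := by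
      refine ⟨n + 1, -(g * X j ^ 2), by simp [hg, hj], ?_⟩
      convert add_mem (Ideal.mul_mem_left _ (X 0 * X i) h) (Ideal.mul_mem_left _ g hij) using 1
      ring
    fin_cases i
    · exact fixed 0 (by simp [substUV])
    · exact fixed 1 (by simp [substUV])
    · exact fixed 2 (by simp [substUV])
    · exact eliminated 3 1 (by simp [substUV]) (left_mem_polyIdeal k)
    · exact eliminated 4 2 (by simp [substUV]) (right_mem_polyIdeal k)

lemma polyIdeal_eq_ker_substUV : polyIdeal k = RingHom.ker (substUV k) := by
  refine le_antisymm (polyIdeal_le_ker_substUV k) fun f hf ↦ ?_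
  obtain ⟨n, g, hg, h⟩ := exists_X_zero_pow_mul_sub_mem k f
  have hker := polyIdeal_le_ker_substUV k h
  rw [RingHom.mem_ker] at hf hker
  rw [map_sub, map_mul, hf, mul_zero, zero_sub, neg_eq_zero, hg,
    map_eq_zero_iff _ (IsFractionRing.injective _ _)] at hker
  subst hker
  exact mem_polyIdeal_of_X_zero_pow_mul_mem k n (by simpa using h)

instance polyIdeal_isPrime : (polyIdeal k).IsPrime := by
  rw [polyIdeal_eq_ker_substUV]
  exact RingHom.ker_isPrime _

lemma polyIdeal_le_m5 : polyIdeal k ≤ m5 k := by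
  rw [polyIdeal, Ideal.span_le]
  rintro _ (rfl | rfl) <;> simp [m5, RingHom.mem_ker]

lemma prime_X_mul_X_add_sq : Prime (X 0 * X 3 + X 1 ^ 2 : Q5 k) := by
  rw [← irreducible_iff_prime]
  refine irreducible_mul_X_add _ _ 3 (X_ne_zero _) (by simp [vars_X]) ?_ ?_
  · intro h
    have := vars_pow _ _ h
    simp [vars_X] at this
  · rw [(X_prime (R := k) (i := (0 : Fin 5))).irreducible.isRelPrime_iff_not_dvd]
    intro h
    have := X_dvd_X.mp ((X_prime (R := k) (i := (0 : Fin 5))).dvd_of_dvd_pow h)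
    exact absurd this (by decide)

lemma span_singleton_lt_polyIdeal :
    Ideal.span {(X 0 * X 3 + X 1 ^ 2 : Q5 k)} < polyIdeal k := by
  refine lt_of_le_of_ne (Ideal.span_mono (by simp)) fun h ↦ ?_
  have hmem := right_mem_polyIdeal k
  rw [← h, Ideal.mem_span_singleton] at hmem
  have := map_dvd (aeval (R := k) ![(1 : k), 0, 0, 0, 1]) hmem
  simp at this

lemma two_le_height_polyIdeal : 2 ≤ (polyIdeal k).height := by
  have hprime : (Ideal.span {(X 0 * X 3 + X 1 ^ 2 : Q5 k)}).IsPrime :=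
    (Ideal.span_singleton_prime (prime_X_mul_X_add_sq k).ne_zero).mpr (prime_X_mul_X_add_sq k)
  have hbot : ⊥ < Ideal.span {(X 0 * X 3 + X 1 ^ 2 : Q5 k)} :=
    bot_lt_iff_ne_bot.mpr (by simpa using (prime_X_mul_X_add_sq k).ne_zero)
  have h₁ := Ideal.height_add_one_le_of_lt_of_isPrime hbot
  have h₂ := Ideal.height_add_one_le_of_lt_of_isPrime (span_singleton_lt_polyIdeal k)
  calc (2 : ℕ∞) = 0 + 1 + 1 := by norm_num
    _ ≤ (⊥ : Ideal (Q5 k)).height + 1 + 1 := by gcongr; exact zero_le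
    _ ≤ (Ideal.span {(X 0 * X 3 + X 1 ^ 2 : Q5 k)}).height + 1 := by gcongr
    _ ≤ _ := h₂

lemma disjoint_primeCompl_polyIdeal :
    Disjoint ((m5 k).primeCompl : Set (Q5 k)) (polyIdeal k) :=
  Set.disjoint_left.mpr fun _ h h' ↦ h (polyIdeal_le_m5 k h')

lemma I8_isPrime : (I8 k).IsPrime := by
  rw [← map_polyIdeal]
  exact IsLocalization.isPrime_of_isPrime_disjoint (m5 k).primeCompl _ _ (polyIdeal_isPrime k)
    (disjoint_primeCompl_polyIdeal k)

lemma I8_height_le : (I8 k).height ≤ 2 := by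
  have := I8_isPrime k
  have hmin : I8 k ∈ (I8 k).minimalPrimes := by
    simp [Ideal.minimalPrimes_eq_subsingleton_self]
  refine (Ideal.height_le_card_of_mem_minimalPrimes_span (Set.toFinite _) hmin).trans ?_
  exact_mod_cast (Set.ncard_insert_le _ _).trans (by rw [Set.ncard_singleton])

lemma height_I8_eq_height_polyIdeal : (I8 k).height = (polyIdeal k).height := by
  have := I8_isPrime k
  rw [← IsLocalization.height_under (m5 k).primeCompl (I8 k), ← map_polyIdeal,
    IsLocalization.under_map_of_isPrime_disjoint (m5 k).primeCompl _ (polyIdeal_isPrime k)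
      (disjoint_primeCompl_polyIdeal k)]

/-- `(xu + y², xv + z²)B₁` is a prime ideal of `B₁` of height two. -/
theorem I8_prime_of_height_two :
    ∃ hp : (I8 k).IsPrime, Order.height (⟨I8 k, hp⟩ : PrimeSpectrum (B1 k)) = 2 := by
  refine ⟨I8_isPrime k, ?_⟩
  rw [← PrimeSpectrum.height_eq_orderHeight]
  exact le_antisymm (I8_height_le k)
    ((two_le_height_polyIdeal k).trans_eq (height_I8_eq_height_polyIdeal k).symm)
end
end

section
/- Let (A, n) be a Noetherian local domain that is a unique factorization domain and whose n-adic completion Â is a normal (integrally closed) domain. Then for every height-one prime ideal P of A, the extension PÂ is an integrally closed ideal of Â. In particular, in a regular local domain A, PÂ is integrally closed for every height-one prime P of A. -/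
noncomputable section

/-- Denominator-free form of complete integral closedness of a domain. -/
def IsCompletelyIntegrallyClosedDomain (R : Type*) [CommRing R] : Prop :=
  IsDomain R ∧ ∀ a b d : R, d ≠ 0 → b ≠ 0 → (∀ k : ℕ, b ^ k ∣ d * a ^ k) → b ∣ a

theorem IsField.isCompletelyIntegrallyClosedDomain {R : Type*} [CommRing R] (h : IsField R) :
    IsCompletelyIntegrallyClosedDomain R := by
  let := h.toField
  exact ⟨inferInstance, fun a b d _ hb _ => (isUnit_iff_ne_zero.mpr hb).dvd⟩

theorem IsCompletelyIntegrallyClosedDomain.isIntegrallyClosed {R : Type*} [CommRing R]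
    (h : IsCompletelyIntegrallyClosedDomain R) : IsIntegrallyClosed R := by
  have := h.1
  rw [isIntegrallyClosed_iff (FractionRing R)]
  intro s hs
  obtain ⟨d, hd, hk⟩ := hs.isAlmostIntegral
  obtain ⟨a, b, hb, rfl⟩ := IsFractionRing.div_surjective (A := R) s
  have hinj := IsFractionRing.injective R (FractionRing R)
  have hb0 : algebraMap R (FractionRing R) b ≠ 0 := by
    simpa using nonZeroDivisors.ne_zero hb
  obtain ⟨c, rfl⟩ := h.2 a b d (nonZeroDivisors.ne_zero hd) (nonZeroDivisors.ne_zero hb) (by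
    intro k
    obtain ⟨y, hy⟩ := hk k
    refine ⟨y, hinj ?_⟩
    rw [Algebra.smul_def] at hy
    simp only [map_mul, map_pow]
    rw [hy, div_pow]
    field_simp)
  exact ⟨c, by simp only [map_mul]; field_simp⟩

theorem dvd_mul_sub_pow {R : Type*} [CommRing R] {a b d : R} (h : ∀ k : ℕ, b ^ k ∣ d * a ^ k)
    (c : R) (k : ℕ) : b ^ k ∣ d * (a - b * c) ^ k := by
  rw [sub_eq_add_neg, add_pow, Finset.mul_sum]
  refine Finset.dvd_sum fun i hi => ?_
  have hi : i ≤ k := Nat.lt_succ_iff.mp (Finset.mem_range.mp hi)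
  obtain ⟨y, hy⟩ := h i
  refine ⟨y * (-c) ^ (k - i) * (k.choose i), ?_⟩
  rw [show d * (a ^ i * (-(b * c)) ^ (k - i) * (k.choose i))
    = (d * a ^ i) * ((b * -c) ^ (k - i) * (k.choose i)) by ring, hy, mul_pow,
    show b ^ k = b ^ i * b ^ (k - i) by rw [← pow_add, Nat.add_sub_cancel' hi]]
  ring

/-- Complete integral closedness lifts along the quotient by a nonzerodivisor `x`
in the ideal of definition of a complete ring. -/
theorem IsCompletelyIntegrallyClosedDomain.of_surjective {R R' : Type*} [CommRing R] [CommRing R']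
    (f : R →+* R') (hf : Function.Surjective f) {x : R} (hker : ∀ r, f r = 0 ↔ x ∣ r)
    (hx : ∀ r, x * r = 0 → r = 0) {𝔪 : Ideal R} (hxm : x ∈ 𝔪)
    (hH : ∀ r : R, (∀ n, r ∈ 𝔪 ^ n) → r = 0)
    (hP : ∀ u : ℕ → R, (∀ i, u i ∈ 𝔪 ^ i) →
      ∃ L, ∀ n, L - ∑ i ∈ Finset.range n, u i ∈ 𝔪 ^ n)
    (h' : IsCompletelyIntegrallyClosedDomain R') : IsCompletelyIntegrallyClosedDomain R := by
  have := h'.1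
  have hpow : ∀ n r, x ^ n * r = 0 → r = 0 := by
    intro n
    induction n with
    | zero => simp
    | succ n ih => exact fun r hr => ih r (hx _ (by rw [← hr]; ring))
  have hcancel : ∀ n r s, x ^ n * r = x ^ n * s → r = s := fun n r s h =>
    sub_eq_zero.mp (hpow n _ (by rw [mul_sub, h, sub_self]))
  have hord : ∀ r, r ≠ 0 → ∃ e r₀, r = x ^ e * r₀ ∧ ¬ x ∣ r₀ := by
    intro r hr
    have : FiniteMultiplicity x r := by
      by_contra hcon
      rw [FiniteMultiplicity.not_iff_forall] at hcon
      exact hr (hH r fun n => Ideal.mem_of_dvd _ (hcon n) (Ideal.pow_mem_pow hxm n))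
    obtain ⟨c, hc, hc'⟩ := this.exists_eq_pow_mul_and_not_dvd
    exact ⟨_, c, hc, hc'⟩
  have hdvd : ∀ r s, x ∣ r * s → x ∣ r ∨ x ∣ s := by
    intro r s h
    rw [← hker, map_mul, mul_eq_zero, hker, hker] at h
    exact h
  have hnu : ¬ x ∣ 1 := by rw [← hker]; simp
  have hnontriv : Nontrivial R := f.domain_nontrivial
  have hdom : IsDomain R := by
    have : NoZeroDivisors R := ⟨by
      intro a b hab
      by_contra! hcon
      obtain ⟨e, a₀, rfl, ha⟩ := hord a hcon.1
      obtain ⟨g, b₀, rfl, hb⟩ := hord b hcon.2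
      have h0 : a₀ * b₀ = 0 := hpow (e + g) _ (by rw [← hab]; ring)
      rcases hdvd a₀ b₀ (h0 ▸ dvd_zero x) with h | h
      exacts [ha h, hb h]⟩
    exact NoZeroDivisors.to_isDomain R
  have hx0 : x ≠ 0 := fun h => one_ne_zero (hx 1 (by simp [h]))
  have hprime : Prime x := ⟨hx0, fun h => hnu h.dvd, hdvd⟩
  refine ⟨hdom, fun a b d hd hb hab => ?_⟩
  obtain ⟨e, b₀, rfl, hb₀⟩ := hord b hb
  obtain ⟨g, d₀, rfl, hd₀⟩ := hord d hd
  set b := x ^ e * b₀ with hbdef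
  set d := x ^ g * d₀ with hddef
  have step : ∀ N a', (∀ k : ℕ, b ^ k ∣ d * (x ^ N * a') ^ k) → ∃ c a'',
      x ^ N * a' = b * (x ^ (N - e) * c) + x ^ (N + 1) * a'' := by
    intro N a' H
    by_cases hxa : x ∣ a'
    · obtain ⟨a'', rfl⟩ := hxa
      exact ⟨0, a'', by ring⟩
    have heN : e ≤ N := by
      by_contra! hlt
      obtain ⟨t, rfl⟩ : ∃ t, e = N + 1 + t := ⟨e - (N + 1), by omega⟩
      obtain ⟨y, hy⟩ := H (g + 1)
      have : d₀ * a' ^ (g + 1) = x * (x ^ (t * (g + 1)) * b₀ ^ (g + 1) * y) := by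
        apply hcancel (g + N * (g + 1))
        calc _ = d * (x ^ N * a') ^ (g + 1) := by rw [hddef]; ring
          _ = _ := by rw [hy, hbdef]; ring
      rcases hprime.dvd_or_dvd (Dvd.intro _ this.symm) with h | h
      exacts [hd₀ h, hxa (hprime.dvd_of_dvd_pow h)]
    obtain ⟨t, rfl⟩ := Nat.exists_eq_add_of_le heN
    have key : f b₀ ∣ f a' := by
      refine h'.2 _ _ (f d₀) (by rwa [Ne, hker]) (by rwa [Ne, hker]) fun k => ?_
      rw [← map_pow, ← map_pow, ← map_mul]
      apply map_dvd
      obtain ⟨y, hy⟩ := H k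
      have h1 : x ^ (g + t * k) * (d₀ * a' ^ k) = b₀ ^ k * y := by
        apply hcancel (e * k)
        calc _ = d * (x ^ (e + t) * a') ^ k := by rw [hddef]; ring
          _ = _ := by rw [hy, hbdef]; ring
      obtain ⟨z, rfl⟩ : x ^ (g + t * k) ∣ y :=
        hprime.pow_dvd_of_dvd_mul_left _ (fun h => hb₀ (hprime.dvd_of_dvd_pow h))
          (Dvd.intro _ h1)
      exact ⟨z, hcancel (g + t * k) _ _ (by rw [h1]; ring)⟩
    obtain ⟨c', hc'⟩ := key
    obtain ⟨c, rfl⟩ := hf c'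
    obtain ⟨a'', ha''⟩ := (hker (a' - b₀ * c)).mp (by simp [hc'])
    refine ⟨c, a'', ?_⟩
    rw [Nat.add_sub_cancel_left, eq_add_of_sub_eq ha'', hbdef]
    ring
  choose! c a'' hstep using step
  let H : ℕ → R → Prop := fun N a' => ∀ k : ℕ, b ^ k ∣ d * (x ^ N * a') ^ k
  have hnext : ∀ N a', H N a' → H (N + 1) (a'' N a') := by
    intro N a' h k
    rw [← sub_eq_of_eq_add' (hstep N a' h)]
    exact dvd_mul_sub_pow h _ k
  let A : ℕ → R := fun N => Nat.rec a (fun N a' => a'' N a') N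
  have hA : ∀ N, H N (A N) := by
    intro N
    induction N with
    | zero => intro k; simpa [A] using hab k
    | succ N ih => exact hnext N _ ih
  have hsum : ∀ N, a = b * ∑ i ∈ Finset.range N, x ^ (i - e) * c i (A i) + x ^ N * A N := by
    intro N
    induction N with
    | zero => simp [A]
    | succ N ih =>
      rw [Finset.sum_range_succ, mul_add, add_assoc, ← hstep N _ (hA N)]
      exact ih
  obtain ⟨L, hL⟩ := hP (fun i => x ^ i * c (e + i) (A (e + i)))
    (fun i => Ideal.mul_mem_right _ _ (Ideal.pow_mem_pow hxm i))
  refine ⟨∑ i ∈ Finset.range e, x ^ (i - e) * c i (A i) + L, sub_eq_zero.mp (hH _ fun n => ?_)⟩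
  have h1 := hsum (e + n)
  rw [Finset.sum_range_add] at h1
  simp only [Nat.add_sub_cancel_left] at h1
  have h2 := Ideal.sub_mem _ (Ideal.mul_mem_right (x ^ e * A (e + n)) _ (Ideal.pow_mem_pow hxm n))
    (Ideal.mul_mem_left _ b (hL n))
  convert! h2 using 1
  nth_rewrite 1 [h1]
  ring

theorem map_colon_of_flat {R S : Type*} [CommRing R] [CommRing S] [Algebra R S] [Module.Flat R S]
    {J K : Ideal R} {b : R} (h : ∀ r, b * r ∈ J → r ∈ K) {s : S}
    (hs : algebraMap R S b * s ∈ J.map (algebraMap R S)) : s ∈ K.map (algebraMap R S) := by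
  obtain ⟨n, g, t, ht⟩ : ∃ (n : ℕ) (g : Fin n → S) (t : Fin n → J),
      ∑ i, g i * algebraMap R S (t i) = algebraMap R S b * s := by
    rw [Ideal.map, Ideal.span, Submodule.mem_span_set'] at hs
    obtain ⟨n, g, t, ht⟩ := hs
    choose t' h1 h2 using fun i => (t i).2
    exact ⟨n, g, fun i => ⟨t' i, h1 i⟩, by simpa [h2] using ht⟩
  have hrel : ∑ i : Option (Fin n), (i.elim b fun j => -(t j : R)) • (i.elim s g : S) = 0 := by
    rw [Fintype.sum_option]
    simp only [Option.elim, Algebra.smul_def, map_neg, neg_mul, Finset.sum_neg_distrib, ← ht]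
    rw [add_neg_eq_zero]
    exact Finset.sum_congr rfl fun i _ => mul_comm _ _
  obtain ⟨l, a, y, hy, ha⟩ := Module.Flat.isTrivialRelation_of_sum_smul_eq_zero (R := R) (M := S) hrel
  have h0 := hy none
  simp only [Option.elim] at h0
  rw [h0]
  refine Ideal.sum_mem _ fun j _ => ?_
  rw [Algebra.smul_def]
  refine Ideal.mul_mem_right _ _ (Ideal.mem_map_of_mem _ (h _ ?_))
  have := ha j
  rw [Fintype.sum_option] at this
  simp only [Option.elim, neg_mul, Finset.sum_neg_distrib, add_neg_eq_zero] at this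
  rw [this]
  exact Ideal.sum_mem _ fun i _ => Ideal.mul_mem_right _ _ (t i).2

theorem isIntegrallyClosedIdeal_span_singleton {R : Type*} [CommRing R] [IsDomain R]
    [IsIntegrallyClosed R] {a : R} (ha : a ≠ 0) : IsIntegrallyClosedIdeal (Ideal.span {a}) := by
  rintro r ⟨n, hn, c, hc, hr⟩
  have hc' : ∀ i, ∃ e, i ∈ Finset.Icc 1 n → c i = a ^ i * e := by
    intro i
    by_cases hi : i ∈ Finset.Icc 1 n
    · have := hc i hi
      rw [Ideal.span_singleton_pow, Ideal.mem_span_singleton] at this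
      exact ⟨this.choose, fun _ => this.choose_spec⟩
    · exact ⟨0, fun h => absurd h hi⟩
  choose e he using hc'
  have haK : algebraMap R (FractionRing R) a ≠ 0 := by simpa using ha
  have hint : IsIntegral R (algebraMap R (FractionRing R) r / algebraMap R (FractionRing R) a) := by
    refine ⟨Polynomial.X ^ n + ∑ i ∈ Finset.Icc 1 n, Polynomial.C (e i) * Polynomial.X ^ (n - i),
      Polynomial.monic_X_pow_add ?_, ?_⟩
    · refine (Polynomial.degree_sum_le _ _).trans_lt ((Finset.sup_lt_iff ?_).mpr fun i hi => ?_)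
      · exact WithBot.bot_lt_coe n
      · refine (Polynomial.degree_C_mul_X_pow_le _ _).trans_lt ?_
        have := Finset.mem_Icc.mp hi
        exact_mod_cast (by omega : n - i < n)
    · simp only [Polynomial.eval₂_add, Polynomial.eval₂_finsetSum, Polynomial.eval₂_mul,
        Polynomial.eval₂_pow, Polynomial.eval₂_X, Polynomial.eval₂_C]
      have h0 := congrArg (algebraMap R (FractionRing R)) hr
      simp only [map_add, map_sum, map_mul, map_pow, map_zero] at h0
      apply (mul_right_injective₀ (pow_ne_zero n haK))
      simp only [mul_zero]
      rw [← h0, mul_add, Finset.mul_sum, div_pow, mul_div_cancel₀ _ (pow_ne_zero n haK)]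
      congr 1
      refine Finset.sum_congr rfl fun i hi => ?_
      have := Finset.mem_Icc.mp hi
      rw [he i hi, map_mul, map_pow, div_pow,
        show algebraMap R (FractionRing R) a ^ n = algebraMap R (FractionRing R) a ^ i * algebraMap R (FractionRing R) a ^ (n - i) by
          rw [← pow_add, Nat.add_sub_cancel' this.2]]
      field_simp
  obtain ⟨y, hy⟩ := IsIntegrallyClosed.isIntegral_iff.mp hint
  rw [Ideal.mem_span_singleton]
  refine ⟨y, IsFractionRing.injective R (FractionRing R) ?_⟩
  rw [map_mul, hy]
  field_simp

theorem IsIntegrallyClosedIdeal.of_mul_mem_iff {R : Type*} [CommRing R] {I J : Ideal R} {b : R}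
    (hJ : IsIntegrallyClosedIdeal J) (h : ∀ r, r ∈ I ↔ b * r ∈ J) : IsIntegrallyClosedIdeal I := by
  rintro r ⟨n, hn, c, hc, hr⟩
  rw [h]
  refine hJ _ ⟨n, hn, fun i => b ^ i * c i, fun i hi => ?_, ?_⟩
  · have hle : Ideal.span {b} * I ≤ J := by
      rw [Ideal.span_singleton_mul_le_iff]
      exact fun z hz => (h z).mp hz
    have h1 := Ideal.pow_right_mono hle i
    rw [mul_pow, Ideal.span_singleton_pow] at h1
    exact h1 (Ideal.mul_mem_mul (Ideal.mem_span_singleton_self _) (hc i hi))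
  · calc _ = b ^ n * (r ^ n + ∑ i ∈ Finset.Icc 1 n, c i * r ^ (n - i)) := by
          rw [mul_add, Finset.mul_sum, mul_pow]
          congr 1
          refine Finset.sum_congr rfl fun i hi => ?_
          have := Finset.mem_Icc.mp hi
          rw [mul_pow, show b ^ n = b ^ i * b ^ (n - i) by
            rw [← pow_add, Nat.add_sub_cancel' this.2]]
          ring
      _ = 0 := by rw [hr, mul_zero]

/-- A height-one prime of a Noetherian domain extends to an integrally closed ideal of
every flat normal domain containing the base. -/
theorem isIntegrallyClosedIdeal_map_of_height_eq_one {R S : Type*} [CommRing R] [IsDomain R]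
    [IsNoetherianRing R] [CommRing S] [IsDomain S] [IsIntegrallyClosed S] [Algebra R S]
    [Module.Flat R S] (P : Ideal R) (hp : P.IsPrime)
    (hP : Order.height (⟨P, hp⟩ : PrimeSpectrum R) = 1) :
    IsIntegrallyClosedIdeal (P.map (algebraMap R S)) := by
  have hbot : P ≠ ⊥ := by
    rintro rfl
    have : IsMin (⟨⊥, hp⟩ : PrimeSpectrum R) := fun Q _ => by
      rw [← PrimeSpectrum.asIdeal_le_asIdeal]
      exact bot_le
    rw [Order.height_eq_zero.mpr this] at hP
    exact zero_ne_one hP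
  obtain ⟨a, haP, ha⟩ := Submodule.exists_mem_ne_zero_of_ne_bot hbot
  have hmin : P ∈ (Ideal.span {a}).minimalPrimes := by
    refine ⟨⟨hp, (Ideal.span_singleton_le_iff_mem _).mpr haP⟩, fun Q hQ hQP => ?_⟩
    by_contra hcon
    have hlt : (⟨Q, hQ.1⟩ : PrimeSpectrum R) < ⟨P, hp⟩ := lt_of_le_not_ge hQP hcon
    have h1 := Order.height_strictMono hlt
      (lt_of_le_of_lt (Order.height_mono hlt.le) (by rw [hP]; exact ENat.one_lt_top))
    rw [hP, Order.lt_one_iff, Order.height_eq_zero] at h1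
    have := h1 (b := ⟨⊥, Ideal.isPrime_bot⟩) (by
      rw [← PrimeSpectrum.asIdeal_le_asIdeal]; exact bot_le)
    have h2 : Q ≤ ⊥ := this
    exact ha (by simpa using h2 (hQ.2 (Ideal.mem_span_singleton_self a)))
  obtain ⟨b, hb⟩ : ∃ b, ∀ r, r ∈ P ↔ b * r ∈ Ideal.span {a} := by
    obtain ⟨b, hb⟩ := Submodule.exists_eq_colon_of_mem_minimalPrimes
      (N := Ideal.span {a}) (x := (1 : R)) (I := P) (by
        rwa [show (Ideal.span {a}).colon {(1 : R)} = Ideal.span {a} from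
          Ideal.ext fun r => by rw [Submodule.mem_colon_singleton, smul_eq_mul, mul_one]])
    exact ⟨b, fun r => by
      rw [hb, Submodule.mem_colon_singleton, smul_eq_mul, mul_comm]⟩
  have haS : algebraMap R S a ≠ 0 := by
    rw [Ne, FaithfulSMul.algebraMap_eq_zero_iff]
    exact ha
  refine (isIntegrallyClosedIdeal_span_singleton haS).of_mul_mem_iff (b := algebraMap R S b)
    fun r => ⟨fun hr => ?_, fun hr => ?_⟩
  · have : P.map (algebraMap R S) ≤
        Submodule.comap (LinearMap.mulLeft S (algebraMap R S b))
          (Ideal.span {algebraMap R S a}) := by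
      refine Ideal.map_le_of_le_comap fun p hp => ?_
      have := Ideal.mem_map_of_mem (algebraMap R S) ((hb p).mp hp)
      rw [Ideal.map_span, Set.image_singleton, map_mul] at this
      exact this
    exact this hr
  · refine map_colon_of_flat (b := b) (fun r => (hb r).mpr) ?_
    rwa [Ideal.map_span, Set.image_singleton]

theorem exists_prime_le_ringKrullDim_quotient {R : Type*} [CommRing R] {J : Ideal R} {n : ℕ}
    (h : n ≤ ringKrullDim (R ⧸ J)) :
    ∃ q : Ideal R, q.IsPrime ∧ J ≤ q ∧ n ≤ ringKrullDim (R ⧸ q) := by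
  rw [ringKrullDim_quotient] at h
  obtain ⟨l, hl⟩ := Order.le_krullDim_iff.mp h
  refine ⟨l.head.1.asIdeal, l.head.1.isPrime, l.head.2, ?_⟩
  rw [ringKrullDim_quotient, Order.le_krullDim_iff]
  refine ⟨⟨l.length, fun i => ⟨(l i).1, ?_⟩, fun i => l.step i⟩, hl⟩
  exact (Subtype.coe_le_coe.mpr (LTSeries.head_le l i) :)

/-- `IsRegularChain J` says that `J` can be completed to the maximal ideal by successively
adjoining elements which are nonzerodivisors modulo the preceding ideal. -/
inductive IsRegularChain {R : Type*} [CommRing R] [IsLocalRing R] : Ideal R → Prop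
  | maximalIdeal : IsRegularChain (IsLocalRing.maximalIdeal R)
  | adjoin (J : Ideal R) (x : R) (hxm : x ∈ IsLocalRing.maximalIdeal R)
      (hx : ∀ r, x * r ∈ J → r ∈ J) (h : IsRegularChain (J ⊔ Ideal.span {x})) : IsRegularChain J

theorem ringKrullDim_quotient_le_card {R : Type*} [CommRing R] [IsNoetherianRing R]
    [IsLocalRing R] (s : Finset R) (J : Ideal R)
    (hs : J ⊔ Ideal.span (s : Set R) = IsLocalRing.maximalIdeal R) :
    ringKrullDim (R ⧸ J) ≤ s.card := by
  classical
  have hJm : J ≤ IsLocalRing.maximalIdeal R := hs ▸ le_sup_left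
  have : Nontrivial (R ⧸ J) := Ideal.Quotient.nontrivial_iff.mpr fun h =>
    (IsLocalRing.maximalIdeal.isMaximal R).ne_top (top_le_iff.mp (h ▸ hJm))
  have : IsLocalRing (R ⧸ J) := .of_surjective' _ Ideal.Quotient.mk_surjective
  have hmap : (IsLocalRing.maximalIdeal R).map (Ideal.Quotient.mk J) =
      IsLocalRing.maximalIdeal (R ⧸ J) := by
    exact IsLocalRing.map_maximalIdeal_of_surjective _ Ideal.Quotient.mk_surjective
  refine (ringKrullDim_le_spanFinrank_maximalIdeal _).trans ?_
  rw [← hmap, ← hs, Ideal.map_sup, Ideal.map_quotient_self, bot_sup_eq, Ideal.map_span]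
  have h1 := Submodule.spanFinrank_span_le_ncard_of_finite (R := R ⧸ J)
    (s := Ideal.Quotient.mk J '' (s : Set R)) (s.finite_toSet.image _)
  have h2 := (Set.ncard_image_le (f := Ideal.Quotient.mk J) s.finite_toSet)
  rw [Set.ncard_coe_finset] at h2
  exact_mod_cast h1.trans h2

theorem isPrime_and_isRegularChain {R : Type*} [CommRing R] [IsNoetherianRing R] [IsLocalRing R]
    (s : Finset R) (J : Ideal R)
    (hs : J ⊔ Ideal.span (s : Set R) = IsLocalRing.maximalIdeal R)
    (hd : s.card ≤ ringKrullDim (R ⧸ J)) : J.IsPrime ∧ IsRegularChain J := by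
  classical
  induction s using Finset.induction_on generalizing J with
  | empty =>
    simp only [Finset.coe_empty, Ideal.span_empty, sup_bot_eq] at hs
    subst hs
    exact ⟨(IsLocalRing.maximalIdeal.isMaximal R).isPrime, .maximalIdeal⟩
  | insert x s hxs ih =>
    rw [Finset.card_insert_of_notMem hxs] at hd
    rw [Finset.coe_insert, Ideal.span_insert, ← sup_assoc] at hs
    have hJ'm : J ⊔ Ideal.span {x} ≤ IsLocalRing.maximalIdeal R := hs ▸ le_sup_left
    have hxm : x ∈ IsLocalRing.maximalIdeal R :=
      hJ'm (Ideal.mem_sup_right (Ideal.mem_span_singleton_self x))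
    have hquot : ∀ q : Ideal R, q ≤ IsLocalRing.maximalIdeal R → ringKrullDim (R ⧸ q) ≤
        ringKrullDim (R ⧸ q ⊔ Ideal.span {x}) + 1 := by
      intro q hq
      have : Nontrivial (R ⧸ q) := Ideal.Quotient.nontrivial_iff.mpr fun h =>
        (IsLocalRing.maximalIdeal.isMaximal R).ne_top (top_le_iff.mp (h ▸ hq))
      have : IsLocalRing (R ⧸ q) := .of_surjective' _ Ideal.Quotient.mk_surjective
      have h1 := ringKrullDim_le_ringKrullDim_quotient_add_card
        ({Ideal.Quotient.mk q x} : Finset (R ⧸ q)) (by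
          rw [IsLocalRing.ringJacobson_eq_maximalIdeal]
          simp only [Finset.coe_singleton, Set.singleton_subset_iff, SetLike.mem_coe]
          rw [← IsLocalRing.map_maximalIdeal_of_surjective _
            (Ideal.Quotient.mk_surjective (I := q))]
          exact Ideal.mem_map_of_mem _ hxm)
      have h2 : Ideal.span {Ideal.Quotient.mk q x} =
          (Ideal.span {x}).map (Ideal.Quotient.mk q) := by
        rw [Ideal.map_span, Set.image_singleton]
      rw [Finset.coe_singleton, h2,
        ringKrullDim_eq_of_ringEquiv (DoubleQuot.quotQuotEquivQuotSup _ _)] at h1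
      simpa using h1
    have hJm : J ≤ IsLocalRing.maximalIdeal R := le_sup_left.trans hJ'm
    have hd' : (s.card : WithBot ℕ∞) ≤ ringKrullDim (R ⧸ J ⊔ Ideal.span {x}) :=
      ENat.WithBot.add_le_add_one_right_iff.mp (by simpa using hd.trans (hquot J hJm))
    obtain ⟨hJ'prime, hchain⟩ := ih _ hs hd'
    have hle := ringKrullDim_quotient_le_card s _ hs
    have hlt : ¬ (((s.card + 1 : ℕ) : WithBot ℕ∞) ≤ s.card) := by
      intro h
      have : s.card + 1 ≤ s.card := by exact_mod_cast h
      omega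
    obtain ⟨q, hq, hJq, hqd⟩ := exists_prime_le_ringKrullDim_quotient hd
    have hqm : q ≤ IsLocalRing.maximalIdeal R := IsLocalRing.le_maximalIdeal hq.ne_top
    have hxq : x ∉ q := by
      intro hxq
      have hle' : J ⊔ Ideal.span {x} ≤ q :=
        sup_le hJq ((Ideal.span_singleton_le_iff_mem _).mpr hxq)
      exact hlt (hqd.trans ((ringKrullDim_le_of_surjective _
        (Ideal.Quotient.factor_surjective hle')).trans hle))
    have hqx : (s.card : WithBot ℕ∞) ≤ ringKrullDim (R ⧸ q ⊔ Ideal.span {x}) :=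
      ENat.WithBot.add_le_add_one_right_iff.mp (by simpa using hqd.trans (hquot q hqm))
    have hqJ' : q ≤ J ⊔ Ideal.span {x} := by
      intro r hr
      by_contra hcon
      have h1 : J ⊔ Ideal.span {x} ≤ q ⊔ Ideal.span {x} := sup_le_sup_right hJq _
      have h2 := ringKrullDim_succ_le_of_surjective (Ideal.Quotient.factor h1)
        (Ideal.Quotient.factor_surjective h1)
        (r := Ideal.Quotient.mk _ r) (mem_nonZeroDivisors_of_ne_zero (by
          rwa [Ne, Ideal.Quotient.eq_zero_iff_mem])) (by
          rw [Ideal.Quotient.factor_mk, Ideal.Quotient.eq_zero_iff_mem]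
          exact Ideal.mem_sup_left hr)
      refine hlt (le_trans ?_ (h2.trans hle))
      push_cast
      gcongr
    have hqJ : q = J := by
      refine le_antisymm ?_ hJq
      refine Submodule.le_of_le_smul_of_le_jacobson_bot (I := IsLocalRing.maximalIdeal R)
        (IsNoetherian.noetherian q) (IsLocalRing.maximalIdeal_le_jacobson _) fun a ha => ?_
      obtain ⟨j, hj, y, hy, rfl⟩ := Submodule.mem_sup.mp (hqJ' ha)
      obtain ⟨t, rfl⟩ := Ideal.mem_span_singleton'.mp hy
      have ht : t * x ∈ q := by simpa using q.sub_mem ha (hJq hj)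
      refine Submodule.add_mem_sup hj ?_
      rw [mul_comm]
      exact Submodule.smul_mem_smul hxm ((hq.mem_or_mem ht).resolve_right hxq)
    subst hqJ
    exact ⟨hq, .adjoin _ x hxm (fun r hr => (hq.mem_or_mem hr).resolve_left hxq) hchain⟩

theorem AdicCompletion.mem_map_of_forall_mem_sup {R : Type*} [CommRing R] [IsNoetherianRing R]
    (I J : Ideal R) (s : AdicCompletion I R)
    (hs : ∀ n, s ∈ J.map (algebraMap R (AdicCompletion I R)) ⊔
      (I.map (algebraMap R (AdicCompletion I R))) ^ n) :
    s ∈ J.map (algebraMap R (AdicCompletion I R)) := by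
  let φ := AdicCompletion.map I J.mkQ
  have hφJ : J.map (algebraMap R (AdicCompletion I R)) ≤ LinearMap.ker φ := by
    refine Submodule.span_le.mpr ?_
    rintro _ ⟨j, hj, rfl⟩
    have h1 : φ (algebraMap R (AdicCompletion I R) j) = AdicCompletion.of I _ (J.mkQ j) :=
      AdicCompletion.map_of I J.mkQ j
    have h2 : J.mkQ j = 0 := (Submodule.Quotient.mk_eq_zero J).mpr hj
    change φ _ = 0
    rw [h1, h2, _root_.map_zero]
  have h0 : φ s = 0 := by
    ext n
    obtain ⟨y, hy, z, hz, rfl⟩ := Submodule.mem_sup.mp (hs n)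
    have hz0 : z.val n = 0 := by
      have h1 : z ∈ (I ^ n • ⊤ : Submodule R (AdicCompletion I R)) := by
        rw [Ideal.smul_top_eq_map, Submodule.restrictScalars_mem, Ideal.map_pow]
        exact hz
      rw [AdicCompletion.pow_smul_top_eq_ker_eval I.fg_of_isNoetherianRing] at h1
      exact h1
    have hy0 : φ y = 0 := hφJ hy
    rw [map_add, hy0, zero_add, AdicCompletion.map_val_apply, hz0, _root_.map_zero]
    rfl
  have hex : Function.Exact (AdicCompletion.map I J.subtype) φ :=
    AdicCompletion.map_exact J.injective_subtype (LinearMap.exact_subtype_mkQ J)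
      J.mkQ_surjective
  obtain ⟨t, rfl⟩ := (hex s).mp h0
  obtain ⟨t, rfl⟩ := AdicCompletion.ofTensorProduct_surjective_of_finite I J t
  clear h0 hs
  induction t using TensorProduct.induction_on with
  | zero => simp
  | add x y hx hy =>
    rw [_root_.map_add, _root_.map_add]
    exact Ideal.add_mem _ hx hy
  | tmul r j =>
    rw [AdicCompletion.ofTensorProduct_tmul, map_smul, AdicCompletion.map_of]
    exact Ideal.mul_mem_left _ r (Ideal.mem_map_of_mem _ j.2)

theorem AdicCompletion.isCompletelyIntegrallyClosedDomain_quotient {R : Type*} [CommRing R]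
    [IsNoetherianRing R] [IsLocalRing R] {J : Ideal R} (hJ : IsRegularChain J) :
    IsCompletelyIntegrallyClosedDomain
      (AdicCompletion (IsLocalRing.maximalIdeal R) R ⧸
        J.map (algebraMap R (AdicCompletion (IsLocalRing.maximalIdeal R) R))) := by
  induction hJ with
  | maximalIdeal =>
    rw [← AdicCompletion.maximalIdeal_eq_map]
    exact ((Ideal.Quotient.maximal_ideal_iff_isField_quotient _).mp
      inferInstance).isCompletelyIntegrallyClosedDomain
  | adjoin J x hxm hx h ih =>
    set S := AdicCompletion (IsLocalRing.maximalIdeal R) R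
    set 𝔫 := IsLocalRing.maximalIdeal S
    have h𝔫 : 𝔫 = (IsLocalRing.maximalIdeal R).map (algebraMap R S) :=
      AdicCompletion.maximalIdeal_eq_map
    have hle : J.map (algebraMap R S) ≤ (J ⊔ Ideal.span {x}).map (algebraMap R S) :=
      Ideal.map_mono le_sup_left
    refine ih.of_surjective (Ideal.Quotient.factor hle) (Ideal.Quotient.factor_surjective hle)
      (x := Ideal.Quotient.mk _ (algebraMap R S x)) (𝔪 := 𝔫.map (Ideal.Quotient.mk _))
      ?_ ?_ ?_ ?_ ?_
    · intro r
      obtain ⟨r, rfl⟩ := Ideal.Quotient.mk_surjective r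
      rw [Ideal.Quotient.factor_mk, Ideal.Quotient.eq_zero_iff_mem, Ideal.map_sup, Ideal.map_span,
        Set.image_singleton, Submodule.mem_sup]
      constructor
      · rintro ⟨y, hy, z, hz, rfl⟩
        rw [map_add, Ideal.Quotient.eq_zero_iff_mem.mpr hy, zero_add]
        exact map_dvd _ (Ideal.mem_span_singleton.mp hz)
      · rintro ⟨c, hc⟩
        obtain ⟨c, rfl⟩ := Ideal.Quotient.mk_surjective c
        rw [← map_mul, Ideal.Quotient.eq] at hc
        exact ⟨_, hc, _, Ideal.mul_mem_right c _ (Ideal.mem_span_singleton_self _),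
          sub_add_cancel _ _⟩
    · intro r hr
      obtain ⟨r, rfl⟩ := Ideal.Quotient.mk_surjective r
      rw [← map_mul, Ideal.Quotient.eq_zero_iff_mem] at hr
      exact Ideal.Quotient.eq_zero_iff_mem.mpr (map_colon_of_flat hx hr)
    · exact Ideal.mem_map_of_mem _ (h𝔫 ▸ Ideal.mem_map_of_mem _ hxm)
    · intro r hr
      obtain ⟨r, rfl⟩ := Ideal.Quotient.mk_surjective r
      rw [Ideal.Quotient.eq_zero_iff_mem]
      refine AdicCompletion.mem_map_of_forall_mem_sup _ _ _ fun n => ?_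
      have := hr n
      rw [← Ideal.map_pow, Ideal.mem_quotient_iff_mem_sup, h𝔫, sup_comm] at this
      exact this
    · intro u hu
      have hlift : ∀ i, ∃ v ∈ 𝔫 ^ i, Ideal.Quotient.mk (J.map (algebraMap R S)) v = u i := by
        intro i
        have := hu i
        rw [← Ideal.map_pow,
          Ideal.mem_map_iff_of_surjective _ Ideal.Quotient.mk_surjective] at this
        exact this
      choose v hv hvu using hlift
      have hcauchy : ∀ {m n : ℕ}, m ≤ n → ∑ i ∈ Finset.range m, v i ≡
          ∑ i ∈ Finset.range n, v i [SMOD (𝔫 ^ m • ⊤ : Submodule S S)] := by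
        intro m n hmn
        rw [SModEq.comm, SModEq.sub_mem, smul_eq_mul, Ideal.mul_top,
          ← Finset.sum_Ico_eq_sub _ hmn]
        exact Ideal.sum_mem _ fun i hi => Ideal.pow_le_pow_right (Finset.mem_Ico.mp hi).1 (hv i)
      obtain ⟨L, hL⟩ := IsPrecomplete.prec (I := 𝔫) inferInstance hcauchy
      refine ⟨Ideal.Quotient.mk _ L, fun n => ?_⟩
      have h1 := hL n
      rw [SModEq.comm, SModEq.sub_mem, smul_eq_mul, Ideal.mul_top] at h1
      have h2 := Ideal.mem_map_of_mem (Ideal.Quotient.mk (J.map (algebraMap R S))) h1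
      rw [Ideal.map_pow, map_sub, map_sum] at h2
      simpa only [hvu] using h2

theorem AdicCompletion.isCompletelyIntegrallyClosedDomain {R : Type*} [CommRing R]
    [IsNoetherianRing R] [IsLocalRing R] (s : Finset R)
    (hs : Ideal.span (s : Set R) = IsLocalRing.maximalIdeal R) (hd : ringKrullDim R = s.card) :
    IsCompletelyIntegrallyClosedDomain (AdicCompletion (IsLocalRing.maximalIdeal R) R) := by
  have hchain := (isPrime_and_isRegularChain s ⊥ (by rwa [bot_sup_eq])
    (by rw [ringKrullDim_eq_of_ringEquiv (RingEquiv.quotientBot R), hd])).2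
  have h := AdicCompletion.isCompletelyIntegrallyClosedDomain_quotient hchain
  rw [Ideal.map_bot] at h
  let e := RingEquiv.quotientBot (AdicCompletion (IsLocalRing.maximalIdeal R) R)
  have := h.1
  refine ⟨e.symm.toMulEquiv.isDomain _, fun a b d hd hb hab => ?_⟩
  have h1 := h.2 (e.symm a) (e.symm b) (e.symm d) (by simpa using hd) (by simpa using hb)
    fun k => by
      rw [← map_pow, ← map_pow, ← map_mul]
      exact map_dvd _ (hab k)
  simpa using map_dvd e h1

/-- If `(A, n)` is a Noetherian local domain which is a UFD and whose
`n`-adic completion `Â` is a normal domain, then `PÂ` is integrally closed for every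
height-one prime `P` of `A`. In particular, this holds in any regular local domain
(a Noetherian local domain whose maximal ideal is generated by `dim A` elements). -/
theorem height_one_prime_extension_integrally_closed
    (A : Type*) [CommRing A] [IsDomain A] [IsNoetherianRing A] [IsLocalRing A]
    [UniqueFactorizationMonoid A]
    (h1 : IsDomain (AdicCompletion (IsLocalRing.maximalIdeal A) A))
    (h2 : IsIntegrallyClosed (AdicCompletion (IsLocalRing.maximalIdeal A) A)) :
    (∀ (P : Ideal A) (hp : P.IsPrime),
      Order.height (⟨P, hp⟩ : PrimeSpectrum A) = 1 →
      IsIntegrallyClosedIdeal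
        (Ideal.map (algebraMap A (AdicCompletion (IsLocalRing.maximalIdeal A) A)) P)) ∧
    (∀ (B : Type*) (_ : CommRing B) (_ : IsDomain B) (_ : IsNoetherianRing B)
        (_ : IsLocalRing B),
      (∃ s : Finset B, Ideal.span (s : Set B) = IsLocalRing.maximalIdeal B ∧
        ringKrullDim B = s.card) →
      ∀ (P : Ideal B) (hp : P.IsPrime),
        Order.height (⟨P, hp⟩ : PrimeSpectrum B) = 1 →
        IsIntegrallyClosedIdeal
          (Ideal.map (algebraMap B (AdicCompletion (IsLocalRing.maximalIdeal B) B)) P)) := by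
  refine ⟨fun P hp hP => isIntegrallyClosedIdeal_map_of_height_eq_one P hp hP,
    fun B _ _ _ _ ⟨s, hs, hd⟩ P hp hP => ?_⟩
  have h := AdicCompletion.isCompletelyIntegrallyClosedDomain s hs hd
  have := h.1
  have := h.isIntegrallyClosed
  exact isIntegrallyClosedIdeal_map_of_height_eq_one P hp hP
end
end

section
/- Let (A, n) be a two-dimensional regular local domain and let Â be its n-adic completion. Then every integrally closed ideal I of A extends to an integrally closed ideal IÂ of Â. -/
noncomputable section

open IsLocalRing

namespace AdicCompletion
variable {A : Type*} [CommRing A]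

lemma evalₐ_eq_zero_iff_eval {I : Ideal A} (N : ℕ) (z : AdicCompletion I A) :
    evalₐ I N z = 0 ↔ eval I A N z = 0 := by
  have h : (I ^ N • ⊤ : Ideal A) = I ^ N := by simp
  rw [← (Ideal.quotientEquivAlgOfEq A h).map_eq_zero_iff]
  rfl

lemma evalₐ_eq_zero_iff {I : Ideal A} (hI : I.FG) (N : ℕ) (z : AdicCompletion I A) :
    evalₐ I N z = 0 ↔ z ∈ I.map (algebraMap A (AdicCompletion I A)) ^ N := by
  rw [evalₐ_eq_zero_iff_eval, ← LinearMap.mem_ker, ← pow_smul_top_eq_ker_eval hI, ← Ideal.map_pow]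
  have := Ideal.smul_restrictScalars (I ^ N) (⊤ : Ideal (AdicCompletion I A))
  rw [smul_eq_mul, Ideal.mul_top] at this
  rw [Submodule.restrictScalars_top] at this
  rw [← this]; rfl

lemma exists_algebraMap_sub_mem {I : Ideal A} (hI : I.FG) (N : ℕ) (z : AdicCompletion I A) :
    ∃ a : A, z - algebraMap A _ a ∈ I.map (algebraMap A (AdicCompletion I A)) ^ N := by
  obtain ⟨a, ha⟩ := Ideal.Quotient.mk_surjective (evalₐ I N z)
  refine ⟨a, ?_⟩
  rw [← evalₐ_eq_zero_iff hI, map_sub, ← ha, AlgHom.commutes]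
  exact sub_self _

lemma mem_pow_of_algebraMap_mem {I : Ideal A} (hI : I.FG) {N : ℕ} {a : A}
    (ha : algebraMap A (AdicCompletion I A) a ∈ I.map (algebraMap A (AdicCompletion I A)) ^ N) :
    a ∈ I ^ N := by
  rw [← evalₐ_eq_zero_iff hI, AlgHom.commutes] at ha
  exact Ideal.Quotient.eq_zero_iff_mem.mp ha

lemma exists_mem_algebraMap_sub_mem {I : Ideal A} (hI : I.FG) (N : ℕ) {J : Ideal A}
    {z : AdicCompletion I A} (hz : z ∈ J.map (algebraMap A (AdicCompletion I A))) :
    ∃ b ∈ J, z - algebraMap A _ b ∈ I.map (algebraMap A (AdicCompletion I A)) ^ N := by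
  induction hz using Submodule.span_induction with
  | mem z hz =>
    obtain ⟨b, hb, rfl⟩ := hz
    exact ⟨b, hb, by simp⟩
  | zero => exact ⟨0, J.zero_mem, by simp⟩
  | add z w _ _ hz hw =>
    obtain ⟨b, hb, hz⟩ := hz
    obtain ⟨c, hc, hw⟩ := hw
    refine ⟨b + c, J.add_mem hb hc, ?_⟩
    convert add_mem hz hw using 1
    rw [map_add]; ring
  | smul c z _ hz =>
    obtain ⟨b, hb, hz⟩ := hz
    obtain ⟨a, ha⟩ := exists_algebraMap_sub_mem hI N c
    refine ⟨a * b, J.mul_mem_left a hb, ?_⟩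
    convert add_mem (Ideal.mul_mem_left _ c hz)
      (Ideal.mul_mem_right (algebraMap A _ b) _ ha) using 1
    rw [map_mul, smul_eq_mul]; ring

/-- Principal ideals generated by elements of a Noetherian domain are closed in its completion. -/
lemma algebraMap_dvd_of_forall_mem [IsDomain A] [IsNoetherianRing A] {I : Ideal A} {x : A}
    (hx : x ≠ 0) {z : AdicCompletion I A}
    (hz : ∀ N, z ∈ Ideal.span {algebraMap A (AdicCompletion I A) x} ⊔
      I.map (algebraMap A (AdicCompletion I A)) ^ N) :
    algebraMap A (AdicCompletion I A) x ∣ z := by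
  have hI : I.FG := IsNoetherian.noetherian I
  have hex : Function.Exact (map I (LinearMap.mulLeft A x)) (map I (Ideal.span {x}).mkQ) :=
    map_exact (mul_right_injective₀ hx) (by
      rw [LinearMap.exact_iff]
      ext y
      simp [Ideal.mem_span_singleton, dvd_def, eq_comm]) (Submodule.mkQ_surjective _)
  obtain ⟨w, rfl⟩ := (hex z).mp (by
    ext n
    obtain ⟨y, hy, w, hw, rfl⟩ := Submodule.mem_sup.mp (hz n)
    obtain ⟨b, hb, hyb⟩ := exists_mem_algebraMap_sub_mem hI n
      (J := Ideal.span {x}) (z := y) (by rwa [Ideal.map_span, Set.image_singleton])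
    have h0 : evalₐ I n (y + w - algebraMap A _ b) = 0 := by
      rw [evalₐ_eq_zero_iff hI]
      convert add_mem hyb hw using 1
      ring
    have h1 : eval I A n (y + w) = eval I A n (of I A b) := by
      rw [← sub_eq_zero, ← map_sub]
      exact (evalₐ_eq_zero_iff_eval n _).mp h0
    rw [map_val_apply, ← eval_apply, h1]
    change Submodule.Quotient.mk ((Ideal.span {x}).mkQ b) = _
    have hb0 : (Ideal.span {x}).mkQ b = 0 := (Submodule.Quotient.mk_eq_zero _).mpr hb
    rw [hb0]
    rfl)
  refine ⟨w, ?_⟩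
  ext n
  rw [map_val_apply, val_mul]
  induction w.val n using Quotient.inductionOn
  rfl
lemma eq_zero_of_algebraMap_mul_eq_zero [IsDomain A] [IsNoetherianRing A] {I : Ideal A}
    {f : A} (hf : f ≠ 0) {r : AdicCompletion I A}
    (h : algebraMap A (AdicCompletion I A) f * r = 0) : r = 0 := by
  have := Module.Flat.isSMulRegular_of_nonZeroDivisors (M := AdicCompletion I A)
    (mem_nonZeroDivisors_of_ne_zero hf)
  exact this.right_eq_zero_of_smul (by rwa [Algebra.smul_def])

end AdicCompletion

section Uniformizer

variable {R : Type*} [CommRing R] {x y : R}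

lemma exists_unit_dvd_sub_pow_mul [IsLocalRing R] (hm : maximalIdeal R = Ideal.span {x, y})
    (hcl : ∀ r, (∀ N, r ∈ Ideal.span {x} ⊔ maximalIdeal R ^ N) → x ∣ r) {r : R} (hr : ¬ x ∣ r) :
    ∃ k u, IsUnit u ∧ x ∣ r - y ^ k * u := by
  by_contra! hcon
  refine hr (hcl r fun N ↦ ?_)
  have hN : ∃ u, x ∣ r - y ^ N * u := by
    induction N with
    | zero => exact ⟨r, by simp⟩
    | succ N ih =>
      obtain ⟨u, s, hs⟩ := ih
      have hu : u ∈ maximalIdeal R := fun hu ↦ hcon N u hu ⟨s, hs⟩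
      rw [hm, Ideal.mem_span_pair] at hu
      obtain ⟨a, b, rfl⟩ := hu
      exact ⟨b, s + y ^ N * a, by linear_combination hs⟩
  obtain ⟨u, s, hs⟩ := hN
  have hy : y ∈ maximalIdeal R := hm ▸ Ideal.subset_span (by simp)
  rw [sub_eq_iff_eq_add.mp hs]
  exact Submodule.add_mem_sup (Ideal.mul_mem_right _ _ (Ideal.mem_span_singleton_self x))
    (Ideal.mul_mem_right _ _ (Ideal.pow_mem_pow hy N))

lemma prime_of_forall_exists_unit (hx0 : x ≠ 0) (hxu : ¬ IsUnit x) (hy : ∀ k, ¬ x ∣ y ^ k)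
    (hxy : ∀ r, ¬ x ∣ r → ∃ k u, IsUnit u ∧ x ∣ r - y ^ k * u) : Prime x := by
  refine ⟨hx0, hxu, fun a b hab ↦ ?_⟩
  by_contra! hcon
  obtain ⟨k, u, hu, s, hs⟩ := hxy a hcon.1
  obtain ⟨l, v, hv, t, ht⟩ := hxy b hcon.2
  obtain ⟨w, hw⟩ := hab
  refine hy (k + l) ((hu.mul hv).dvd_mul_right.mp ⟨w - s * b - t * y ^ k * u, ?_⟩)
  linear_combination hw - b * hs - y ^ k * u * ht

lemma isDomain_of_prime (hx : Prime x) (hreg : ∀ r, x * r = 0 → r = 0)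
    (hsep : ∀ r, (∀ n, x ^ n ∣ r) → r = 0) : IsDomain R := by
  have : Nontrivial R := ⟨⟨x, 0, hx.ne_zero⟩⟩
  have hfin : ∀ r, r ≠ 0 → ∃ n s, r = x ^ n * s ∧ ¬ x ∣ s := fun r hr ↦ by
    have hf : FiniteMultiplicity x r := by
      by_contra hf
      exact hr (hsep r (FiniteMultiplicity.not_iff_forall.mp hf))
    obtain ⟨s, hs, hxs⟩ := hf.exists_eq_pow_mul_and_not_dvd
    exact ⟨_, s, hs, hxs⟩
  have hpow : ∀ n r, x ^ n * r = 0 → r = 0 := fun n ↦ by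
    induction n with
    | zero => simp
    | succ n ih => exact fun r hr ↦ ih r (hreg _ (by rw [← hr]; ring))
  have : NoZeroDivisors R := ⟨fun {a b} hab ↦ by
    by_contra! hcon
    obtain ⟨n, s, rfl, hs⟩ := hfin a hcon.1
    obtain ⟨m, t, rfl, ht⟩ := hfin b hcon.2
    have hst : s * t = 0 := hpow (n + m) _ (by rw [← hab]; ring)
    exact (hx.dvd_or_dvd (hst ▸ dvd_zero x)).elim hs ht⟩
  exact NoZeroDivisors.to_isDomain R

lemma isPrime_eq_span_or_eq_maximalIdeal [IsLocalRing R] (hm : maximalIdeal R = Ideal.span {x, y})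
    (hxy : ∀ r, ¬ x ∣ r → ∃ k u, IsUnit u ∧ x ∣ r - y ^ k * u)
    (hnak : ∀ (P : Ideal R) (a : R), P ≤ Ideal.span {a} ⊔ Ideal.span {x} * P → P ≤ Ideal.span {a})
    (P : Ideal R) [hP : P.IsPrime] : (∃ a, P = Ideal.span {a}) ∨ P = maximalIdeal R := by
  by_cases hxP : x ∈ P
  · by_cases hle : P ≤ Ideal.span {x}
    · exact .inl ⟨x, le_antisymm hle (by simpa [Ideal.span_singleton_le_iff_mem])⟩
    · obtain ⟨r, hr, hxr⟩ := SetLike.not_le_iff_exists.mp hle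
      rw [Ideal.mem_span_singleton] at hxr
      obtain ⟨k, u, hu, s, hs⟩ := hxy r hxr
      have hyP : y ∈ P := by
        have : y ^ k * u ∈ P := by
          rw [show y ^ k * u = r - x * s by linear_combination -hs]
          exact sub_mem hr (P.mul_mem_right s hxP)
        exact hP.mem_of_pow_mem k ((hP.mem_or_mem this).resolve_right
          fun h ↦ hP.ne_top (P.eq_top_of_isUnit_mem h hu))
      refine .inr (le_antisymm (le_maximalIdeal hP.ne_top) ?_)
      rw [hm, Ideal.span_le]
      rintro z (rfl | rfl) <;> assumption
  · have hmul : ∀ s, x * s ∈ P → x * s ∈ Ideal.span {x} * P := fun s hs ↦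
      Ideal.mul_mem_mul (Ideal.mem_span_singleton_self x) ((hP.mem_or_mem hs).resolve_left hxP)
    suffices ∃ a ∈ P, P ≤ Ideal.span {a} ⊔ Ideal.span {x} * P by
      obtain ⟨a, ha, hPa⟩ := this
      exact .inl ⟨a, le_antisymm (hnak P a hPa) (by simpa [Ideal.span_singleton_le_iff_mem])⟩
    classical
    by_cases hex : ∃ k, ∃ a ∈ P, ∃ u, IsUnit u ∧ x ∣ a - y ^ k * u
    · obtain ⟨a, ha, u, hu, s, hs⟩ := Nat.find_spec hex
      refine ⟨a, ha, fun p hp ↦ ?_⟩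
      by_cases hxp : x ∣ p
      · obtain ⟨t, rfl⟩ := hxp
        exact Ideal.mem_sup_right (hmul t hp)
      · obtain ⟨l, v, hv, t, ht⟩ := hxy p hxp
        obtain ⟨d, hd⟩ := Nat.exists_eq_add_of_le (Nat.find_min' hex ⟨p, hp, v, hv, t, ht⟩)
        obtain ⟨u', hu'⟩ := hu.exists_right_inv
        have key : p - a * (y ^ d * u' * v) = x * (t - s * (y ^ d * u' * v)) := by
          have : y ^ l = y ^ Nat.find hex * y ^ d := by rw [hd, pow_add]
          linear_combination ht - y ^ d * u' * v * hs + v * this -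
            y ^ Nat.find hex * y ^ d * v * hu'
        rw [← sub_add_cancel p (a * (y ^ d * u' * v)), add_comm]
        refine Submodule.add_mem_sup (Ideal.mul_mem_right _ _ (Ideal.mem_span_singleton_self a)) ?_
        rw [key]
        exact hmul _ (key ▸ sub_mem hp (P.mul_mem_right _ ha))
    · refine ⟨0, P.zero_mem, fun p hp ↦ Ideal.mem_sup_right ?_⟩
      by_cases hxp : x ∣ p
      · obtain ⟨t, rfl⟩ := hxp
        exact hmul t hp
      · obtain ⟨k, u, hu, h⟩ := hxy p hxp
        exact absurd ⟨k, p, hp, u, hu, h⟩ hex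

lemma uniqueFactorizationMonoid_of_isPrime_eq_span_or [IsDomain R] [IsLocalRing R] (hx : Prime x)
    (hP : ∀ P : Ideal R, P.IsPrime → (∃ a, P = Ideal.span {a}) ∨ P = maximalIdeal R) :
    UniqueFactorizationMonoid R := by
  rw [UniqueFactorizationMonoid.iff_exists_prime_mem_of_isPrime]
  intro P hP0 hPp
  obtain ⟨a, rfl⟩ | rfl := hP P hPp
  · exact ⟨a, Ideal.mem_span_singleton_self a,
      (Ideal.span_singleton_prime (by simpa using hP0)).mp hPp⟩
  · exact ⟨x, hx.not_isUnit, hx⟩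

lemma le_span_singleton_of_le_sup [IsLocalRing R] [IsNoetherianRing R] (hx : x ∈ maximalIdeal R)
    {P : Ideal R} {a : R} (h : P ≤ Ideal.span {a} ⊔ Ideal.span {x} * P) : P ≤ Ideal.span {a} :=
  Submodule.le_of_le_smul_of_le_jacobson_bot (I := Ideal.span {x}) (IsNoetherian.noetherian P)
    (by rw [Ideal.span_singleton_le_iff_mem]; exact maximalIdeal_le_jacobson _ hx) h

lemma IsAdicComplete.le_span_singleton_of_le_sup {I : Ideal R} [IsAdicComplete I R] (hx : x ∈ I)
    {P : Ideal R} {a : R} (h : P ≤ Ideal.span {a} ⊔ Ideal.span {x} * P) : P ≤ Ideal.span {a} := by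
  have hstep : ∀ p : P, ∃ r : R, ∃ q : P, (p : R) = a * r + x * q := fun p ↦ by
    obtain ⟨b, hb, c, hc, hbc⟩ := Submodule.mem_sup.mp (h p.2)
    obtain ⟨r, rfl⟩ := Ideal.mem_span_singleton.mp hb
    obtain ⟨q, hq, rfl⟩ := Ideal.mem_span_singleton_mul.mp hc
    exact ⟨r, ⟨q, hq⟩, hbc.symm⟩
  choose f g hfg using hstep
  intro p hp
  let q : ℕ → P := fun n ↦ g^[n] ⟨p, hp⟩
  let S : ℕ → R := fun n ↦ ∑ i ∈ Finset.range n, x ^ i * f (q i)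
  have hS : ∀ n, p - a * S n = x ^ n * q n := fun n ↦ by
    induction n with
    | zero => simp [S, q]
    | succ n ih =>
      have hq : q (n + 1) = g (q n) := Function.iterate_succ_apply' g n _
      rw [hq]
      simp only [S, Finset.sum_range_succ] at ih ⊢
      linear_combination ih + x ^ n * hfg (q n)
  obtain ⟨L, hL⟩ := IsPrecomplete.prec (I := I) inferInstance (f := S) (fun {m n} hmn ↦ by
    rw [SModEq.sub_mem, ← neg_mem_iff, neg_sub, Finset.sum_range_sub_sum_range hmn]
    refine sum_mem fun i hi ↦ ?_
    rw [smul_eq_mul, Ideal.mul_top]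
    exact Ideal.mul_mem_right _ _ (Ideal.pow_le_pow_right (Finset.mem_filter.mp hi).2
      (Ideal.pow_mem_pow hx i)))
  rw [Ideal.mem_span_singleton]
  refine ⟨L, sub_eq_zero.mp (IsHausdorff.haus (I := I) inferInstance _ fun n ↦ ?_)⟩
  have := hL n
  rw [SModEq.sub_mem, smul_eq_mul, Ideal.mul_top] at this
  rw [SModEq.zero, smul_eq_mul, Ideal.mul_top,
    show p - a * L = x ^ n * q n + a * (S n - L) by linear_combination hS n]
  exact add_mem (Ideal.mul_mem_right _ _ (Ideal.pow_mem_pow hx n)) (Ideal.mul_mem_left _ _ this)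

end Uniformizer

section IntegralOverIdeal

variable {R : Type*} [CommRing R] {J : Ideal R}

lemma IsIntegralOverIdeal.eq_zero_of_bot [IsReduced R] {r : R}
    (h : IsIntegralOverIdeal (⊥ : Ideal R) r) : r = 0 := by
  obtain ⟨n, hn, a, ha, h⟩ := h
  rw [Finset.sum_eq_zero, add_zero] at h
  · exact eq_zero_of_pow_eq_zero h
  · intro i hi
    have := ha i hi
    rw [Ideal.bot_pow (by have := (Finset.mem_Icc.mp hi).1; omega), Ideal.mem_bot] at this
    rw [this, zero_mul]

lemma IsIntegralOverIdeal.mul_left (f : R) {r : R} (h : IsIntegralOverIdeal J r) :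
    IsIntegralOverIdeal (Ideal.span {f} * J) (f * r) := by
  obtain ⟨n, hn, a, ha, h⟩ := h
  refine ⟨n, hn, fun i ↦ f ^ i * a i, fun i hi ↦ ?_, ?_⟩
  · rw [mul_pow, Ideal.span_singleton_pow]
    exact Ideal.mul_mem_mul (Ideal.mem_span_singleton_self _) (ha i hi)
  · rw [← mul_zero (f ^ n), ← h, mul_add, mul_pow, Finset.mul_sum]
    congr 1
    refine Finset.sum_congr rfl fun i hi ↦ ?_
    obtain ⟨d, rfl⟩ := Nat.exists_eq_add_of_le (Finset.mem_Icc.mp hi).2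
    rw [Nat.add_sub_cancel_left, pow_add]
    ring

lemma IsIntegralOverIdeal.exists_eq_mul [IsDomain R] [IsIntegrallyClosed R] {f r : R} (hf : f ≠ 0)
    (h : IsIntegralOverIdeal (Ideal.span {f} * J) r) :
    ∃ s, r = f * s ∧ IsIntegralOverIdeal J s := by
  obtain ⟨n, hn, a, ha, h⟩ := h
  have hb : ∀ i, ∃ b, i ∈ Finset.Icc 1 n → b ∈ J ^ i ∧ a i = f ^ i * b := fun i ↦ by
    by_cases hi : i ∈ Finset.Icc 1 n
    · have := ha i hi
      rw [mul_pow, Ideal.span_singleton_pow, Ideal.mem_span_singleton_mul] at this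
      obtain ⟨b, hb, hab⟩ := this
      exact ⟨b, fun _ ↦ ⟨hb, hab.symm⟩⟩
    · exact ⟨0, fun h ↦ absurd h hi⟩
  choose b hb using hb
  have hscale : ∀ {S : Type _} [CommRing S] (φ : R →+* S) (s : S), φ f * s = φ r →
      φ f ^ n * (s ^ n + ∑ i ∈ Finset.Icc 1 n, φ (b i) * s ^ (n - i)) = 0 := fun φ s hs ↦ by
    rw [← map_zero φ, ← h, map_add, map_sum, map_pow, ← hs, mul_add, mul_pow, Finset.mul_sum]
    congr 1
    refine Finset.sum_congr rfl fun i hi ↦ ?_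
    rw [(hb i hi).2, map_mul, map_mul, map_pow, map_pow, ← hs]
    obtain ⟨d, rfl⟩ := Nat.exists_eq_add_of_le (Finset.mem_Icc.mp hi).2
    rw [Nat.add_sub_cancel_left, pow_add]
    ring
  let K := FractionRing R
  have hfK : algebraMap R K f ≠ 0 := by simpa using hf
  have hz : algebraMap R K f * (algebraMap R K r / algebraMap R K f) = algebraMap R K r :=
    mul_div_cancel₀ _ hfK
  have hint : IsIntegral R (algebraMap R K r / algebraMap R K f) := by
    refine ⟨Polynomial.X ^ n + ∑ i ∈ Finset.Icc 1 n, Polynomial.C (b i) * Polynomial.X ^ (n - i),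
      Polynomial.monic_X_pow_add ?_, ?_⟩
    · refine (Polynomial.degree_sum_le _ _).trans_lt
        ((Finset.sup_lt_iff (WithBot.bot_lt_coe n)).mpr fun i hi ↦ ?_)
      refine (Polynomial.degree_C_mul_X_pow_le _ _).trans_lt ?_
      rw [Finset.mem_Icc] at hi
      exact WithBot.coe_lt_coe.mpr (by omega : n - i < n)
    · have := (mul_eq_zero.mp (hscale (algebraMap R K) _ hz)).resolve_left (pow_ne_zero n hfK)
      simpa [Polynomial.eval₂_finsetSum] using this
  obtain ⟨s, hs⟩ := IsIntegrallyClosed.isIntegral_iff.mp hint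
  have hrs : f * s = r := by
    apply IsFractionRing.injective R K
    rw [map_mul, hs, hz]
  refine ⟨s, hrs.symm, n, hn, b, fun i hi ↦ (hb i hi).1, ?_⟩
  exact (mul_eq_zero.mp (hscale (RingHom.id R) s hrs)).resolve_left (pow_ne_zero n hf)

lemma IsIntegrallyClosedIdeal.of_span_singleton_mul [IsDomain R] {f : R} (hf : f ≠ 0)
    (h : IsIntegrallyClosedIdeal (Ideal.span {f} * J)) : IsIntegrallyClosedIdeal J := by
  intro r hr
  obtain ⟨s, hs, hfs⟩ := Ideal.mem_span_singleton_mul.mp (h _ (hr.mul_left f))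
  rwa [← mul_left_cancel₀ hf hfs]

lemma exists_eq_span_singleton_mul_and_pow_le [IsDomain R] [IsNoetherianRing R] [IsLocalRing R]
    (hP : ∀ P : Ideal R, P.IsPrime → (∃ a, P = Ideal.span {a}) ∨ P = maximalIdeal R)
    {I : Ideal R} (hI : I ≠ ⊥) :
    ∃ f, f ≠ 0 ∧ ∃ J : Ideal R, I = Ideal.span {f} * J ∧ ∃ k, maximalIdeal R ^ k ≤ J := by
  obtain ⟨J, ⟨f, hf, hfJ⟩, hmax⟩ := set_has_maximal_iff_noetherian.mpr ‹IsNoetherianRing R›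
    {J : Ideal R | ∃ f, f ≠ 0 ∧ I = Ideal.span {f} * J} ⟨I, 1, one_ne_zero, by simp⟩
  refine ⟨f, hf, J, hfJ, Ideal.exists_pow_le_of_le_radical_of_fg ?_ (IsNoetherian.noetherian _)⟩
  have hJ : J ≠ ⊥ := by
    rintro rfl
    exact hI (by rw [hfJ, Ideal.mul_bot])
  rw [Ideal.radical_eq_sInf]
  refine le_sInf fun P ⟨hJP, hPp⟩ ↦ ?_
  obtain ⟨a, rfl⟩ | rfl := hP P hPp
  swap
  · exact le_rfl
  exfalso
  have ha : a ≠ 0 := by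
    rintro rfl
    exact hJ (by simpa using hJP)
  let J' : Ideal R := Submodule.comap (LinearMap.mulLeft R a) J
  have hJ' : J = Ideal.span {a} * J' := by
    apply le_antisymm
    · intro z hz
      obtain ⟨w, rfl⟩ := Ideal.mem_span_singleton.mp (hJP hz)
      exact Ideal.mul_mem_mul (Ideal.mem_span_singleton_self a) hz
    · intro z hz
      obtain ⟨w, hw, rfl⟩ := Ideal.mem_span_singleton_mul.mp hz
      exact hw
  have hle : J ≤ J' := fun z hz ↦ Ideal.mul_mem_left J a hz
  have heq : J = J' := by
    by_contra hne
    refine hmax J' ⟨f * a, mul_ne_zero hf ha, ?_⟩ (lt_of_le_of_ne hle hne)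
    rw [← Ideal.span_singleton_mul_span_singleton, mul_assoc, ← hJ', hfJ]
  have ham : a ∈ maximalIdeal R := le_maximalIdeal hPp.ne_top (Ideal.mem_span_singleton_self a)
  rw [← heq] at hJ'
  have := le_span_singleton_of_le_sup (a := 0) ham (le_sup_of_le_right hJ'.le)
  exact hJ (by simpa using this)

end IntegralOverIdeal

section Completion

variable {A : Type*} [CommRing A]

lemma IsIntegrallyClosedIdeal.map_adicCompletion_of_pow_le {I J : Ideal A} (hI : I.FG) {k : ℕ}
    (hk : I ^ k ≤ J) (hJ : IsIntegrallyClosedIdeal J) :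
    IsIntegrallyClosedIdeal (J.map (algebraMap A (AdicCompletion I A))) := by
  rintro r ⟨n, hn, a, ha, h⟩
  obtain ⟨c, hc⟩ := AdicCompletion.exists_algebraMap_sub_mem hI (k * n) r
  have hb : ∀ i, ∃ b, i ∈ Finset.Icc 1 n → b ∈ J ^ i ∧ a i - algebraMap A _ b ∈
      I.map (algebraMap A (AdicCompletion I A)) ^ (k * n) := fun i ↦ by
    by_cases hi : i ∈ Finset.Icc 1 n
    · have := ha i hi
      rw [← Ideal.map_pow] at this
      obtain ⟨b, hb⟩ := AdicCompletion.exists_mem_algebraMap_sub_mem hI (k * n) this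
      exact ⟨b, fun _ ↦ hb⟩
    · exact ⟨0, fun h ↦ absurd h hi⟩
  choose b hb using hb
  set E := c ^ n + ∑ i ∈ Finset.Icc 1 n, b i * c ^ (n - i) with hE
  have hEJ : E ∈ J ^ n := by
    have : E ∈ I ^ (k * n) := by
      refine AdicCompletion.mem_pow_of_algebraMap_mem hI ?_
      rw [← Ideal.Quotient.eq_zero_iff_mem, ← map_zero (Ideal.Quotient.mk _), ← h, hE]
      simp only [map_add, map_sum, map_mul, map_pow]
      rw [← Ideal.Quotient.mk_eq_mk_iff_sub_mem] at hc
      rw [hc]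
      congr 1
      refine Finset.sum_congr rfl fun i hi ↦ ?_
      rw [(Ideal.Quotient.mk_eq_mk_iff_sub_mem _ _).mpr (hb i hi).2]
    rw [pow_mul] at this
    exact Ideal.pow_right_mono hk n this
  have hcJ : c ∈ J := by
    refine hJ c ⟨n, hn, fun i ↦ if i = n then b n - E else b i, fun i hi ↦ ?_, ?_⟩
    · dsimp only
      split_ifs with hin
      · subst hin
        exact sub_mem (hb i hi).1 hEJ
      · exact (hb i hi).1
    · have hsum : ∑ i ∈ Finset.Icc 1 n, (if i = n then b n - E else b i) * c ^ (n - i) =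
          ∑ i ∈ Finset.Icc 1 n, (b i * c ^ (n - i) - if i = n then E else 0) := by
        refine Finset.sum_congr rfl fun i _ ↦ ?_
        split_ifs with hin
        · subst hin; simp
        · simp
      rw [hsum, Finset.sum_sub_distrib, Finset.sum_ite_eq', if_pos (Finset.mem_Icc.mpr ⟨hn, le_rfl⟩),
        ← add_sub_assoc, ← hE, sub_self]
  rw [← sub_add_cancel r (algebraMap A _ c)]
  refine add_mem ?_ (Ideal.mem_map_of_mem _ hcJ)
  have hkn : I ^ (k * n) ≤ J := (Ideal.pow_le_pow_right (Nat.le_mul_of_pos_right k hn)).trans hk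
  exact Ideal.map_mono hkn (by rwa [Ideal.map_pow])

variable [IsNoetherianRing A] [IsLocalRing A] {x y : A}

lemma dvd_of_forall_mem_sup_maximalIdeal_pow {r : A}
    (hr : ∀ N, r ∈ Ideal.span {x} ⊔ maximalIdeal A ^ N) : x ∣ r := by
  rw [← Ideal.mem_span_singleton, ← Ideal.Quotient.eq_zero_iff_mem]
  refine IsHausdorff.haus (I := maximalIdeal A) (M := A ⧸ Ideal.span {x}) inferInstance _
    fun N ↦ ?_
  obtain ⟨s, hs, t, ht, rfl⟩ := Submodule.mem_sup.mp (hr N)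
  rw [SModEq.zero, map_add, Ideal.Quotient.eq_zero_iff_mem.mpr hs, zero_add,
    ← mul_one t, map_mul]
  exact Submodule.smul_mem_smul (r := t) (n := (1 : A ⧸ Ideal.span {x})) ht Submodule.mem_top

lemma not_dvd_pow_of_ringKrullDim_eq_two (hm : maximalIdeal A = Ideal.span {x, y})
    (hdim : ringKrullDim A = 2) (k : ℕ) : ¬ x ∣ y ^ k := by
  intro hxy
  have hmin : maximalIdeal A ∈ (Ideal.span {x}).minimalPrimes := by
    refine ⟨⟨inferInstance, ?_⟩, fun P ⟨hP, hxP⟩ _ ↦ ?_⟩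
    · rw [hm]
      exact Ideal.span_mono (by simp)
    · rw [Ideal.span_singleton_le_iff_mem] at hxP
      have hyP : y ∈ P := hP.mem_of_pow_mem k (P.mem_of_dvd hxy hxP)
      rw [hm, Ideal.span_le]
      rintro z (rfl | rfl) <;> assumption
  have h1 := Ideal.height_le_one_of_isPrincipal_of_mem_minimalPrimes _ _ hmin
  have h2 := IsLocalRing.maximalIdeal_height_eq_ringKrullDim (R := A)
  have h3 : ((maximalIdeal A).height : WithBot ℕ∞) ≤ (1 : ℕ∞) := WithBot.coe_le_coe.mpr h1
  rw [h2, hdim] at h3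
  exact absurd h3 (by decide)

lemma exists_isDomain_and_uniqueFactorizationMonoid_adicCompletion [IsDomain A]
    (hm : maximalIdeal A = Ideal.span {x, y}) (hdim : ringKrullDim A = 2) :
    ∃ _ : IsDomain (AdicCompletion (maximalIdeal A) A),
      UniqueFactorizationMonoid (AdicCompletion (maximalIdeal A) A) := by
  set B := AdicCompletion (maximalIdeal A) A
  let φ := algebraMap A B
  have hy := not_dvd_pow_of_ringKrullDim_eq_two hm hdim
  have hx0 : x ≠ 0 := by
    rintro rfl
    refine not_dvd_pow_of_ringKrullDim_eq_two (x := y) (y := 0) ?_ hdim 1 (by simp)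
    rw [hm, Set.pair_comm]
  have hxm : x ∈ maximalIdeal A := hm ▸ Ideal.subset_span (by simp)
  have hmB : maximalIdeal B = (maximalIdeal A).map φ := AdicCompletion.maximalIdeal_eq_map
  have hmB' : maximalIdeal B = Ideal.span {φ x, φ y} := by
    rw [hmB, ← Set.image_pair, ← Ideal.map_span]
    exact congrArg (Ideal.map φ) hm
  have hxB : φ x ∈ maximalIdeal B := hmB' ▸ Ideal.subset_span (by simp)
  have hreg : ∀ r, φ x * r = 0 → r = 0 := fun r hr ↦
    AdicCompletion.eq_zero_of_algebraMap_mul_eq_zero hx0 hr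
  have hstr : ∀ r, ¬ φ x ∣ r → ∃ k u, IsUnit u ∧ φ x ∣ r - φ y ^ k * u := fun _ ↦
    exists_unit_dvd_sub_pow_mul hmB' fun r hr ↦
    AdicCompletion.algebraMap_dvd_of_forall_mem hx0 (hmB ▸ hr)
  have hyB : ∀ k, ¬ φ x ∣ φ y ^ k := fun k hk ↦ by
    refine hy k (dvd_of_forall_mem_sup_maximalIdeal_pow fun N ↦ ?_)
    rw [← map_pow, ← Ideal.mem_span_singleton, ← Set.image_singleton, ← Ideal.map_span] at hk
    obtain ⟨b, hb, hyb⟩ := AdicCompletion.exists_mem_algebraMap_sub_mem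
      (maximalIdeal A).fg_of_isNoetherianRing N hk
    rw [← map_sub] at hyb
    rw [← add_sub_cancel b (y ^ k)]
    exact Submodule.add_mem_sup hb
      (AdicCompletion.mem_pow_of_algebraMap_mem (maximalIdeal A).fg_of_isNoetherianRing hyb)
  have hp : Prime (φ x) := prime_of_forall_exists_unit
    (fun h ↦ one_ne_zero (hreg 1 (by rw [h, zero_mul]))) hxB hyB hstr
  have hdom : IsDomain B := isDomain_of_prime hp hreg fun r hr ↦
    IsHausdorff.haus (I := maximalIdeal B) inferInstance r fun n ↦ by
      rw [SModEq.zero, smul_eq_mul, Ideal.mul_top]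
      exact Ideal.mem_of_dvd _ (hr n) (Ideal.pow_mem_pow hxB n)
  exact ⟨hdom, uniqueFactorizationMonoid_of_isPrime_eq_span_or hp fun P _ ↦
    isPrime_eq_span_or_eq_maximalIdeal hmB' hstr
      (fun _ _ ↦ IsAdicComplete.le_span_singleton_of_le_sup hxB) P⟩

end Completion

/-- If `(A, n)` is a two-dimensional regular local domain, then every
integrally closed ideal of `A` extends to an integrally closed ideal of the `n`-adic
completion `Â`. -/
theorem two_dim_regular_integrally_closed_extends
    (A : Type*) [CommRing A] [IsDomain A] [IsNoetherianRing A] [IsLocalRing A]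
    (hreg : ∃ s : Finset A, s.card = 2 ∧
      Ideal.span (s : Set A) = IsLocalRing.maximalIdeal A)
    (hdim : ringKrullDim A = 2) :
    ∀ I : Ideal A, IsIntegrallyClosedIdeal I →
      IsIntegrallyClosedIdeal
        (Ideal.map (algebraMap A (AdicCompletion (IsLocalRing.maximalIdeal A) A)) I) := by
  classical
  obtain ⟨s, hs, hsm⟩ := hreg
  obtain ⟨x, y, -, rfl⟩ := Finset.card_eq_two.mp hs
  have hm : maximalIdeal A = Ideal.span {x, y} := by simpa using hsm.symm
  have hxm : x ∈ maximalIdeal A := hm ▸ Ideal.subset_span (by simp)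
  obtain ⟨_, _⟩ := exists_isDomain_and_uniqueFactorizationMonoid_adicCompletion hm hdim
  intro I hI r hr
  by_cases hI0 : I = ⊥
  · subst hI0
    rw [Ideal.map_bot] at hr ⊢
    exact hr.eq_zero_of_bot
  have hP : ∀ P : Ideal A, P.IsPrime → (∃ a, P = Ideal.span {a}) ∨ P = maximalIdeal A :=
    fun P _ ↦ isPrime_eq_span_or_eq_maximalIdeal hm
      (fun r ↦ exists_unit_dvd_sub_pow_mul hm fun r ↦ dvd_of_forall_mem_sup_maximalIdeal_pow)
      (fun _ _ ↦ le_span_singleton_of_le_sup hxm) P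
  obtain ⟨f, hf, J, rfl, k, hk⟩ := exists_eq_span_singleton_mul_and_pow_le hP hI0
  rw [Ideal.map_mul, Ideal.map_span, Set.image_singleton] at hr ⊢
  have hf' : algebraMap A (AdicCompletion (maximalIdeal A) A) f ≠ 0 := fun h ↦
    one_ne_zero (AdicCompletion.eq_zero_of_algebraMap_mul_eq_zero hf
      (show _ * (1 : AdicCompletion (maximalIdeal A) A) = 0 by rw [h, zero_mul]))
  obtain ⟨t, rfl, ht⟩ := hr.exists_eq_mul hf'
  exact Ideal.mul_mem_mul (Ideal.mem_span_singleton_self _)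
    ((hI.of_span_singleton_mul hf).map_adicCompletion_of_pow_le
      (maximalIdeal A).fg_of_isNoetherianRing hk t ht)
end
end
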